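/- arXiv:1111.1379 — 2 statements merged into one kernel-verified Lean document; each statement's English description precedes it below -/
import Mathlib

section
/- Let f be a nonconstant entire function of order at most 1, all of whose zeros have multiplicity at least k, where k is a positive integer with k ≠ 2, and let a ≠ 0 be a complex constant. If every zero of f is a zero of f^{(k)} − a, and every zero of f^{(k)} − a is a zero of f^{(k+1)}, then f(z) = a(z − b)^k / k! for some constant b ∈ ℂ. -/
open Filter Topology Metric MeasureTheory


/-- Gluing lemma. -/
lemma cfz_glue (H : ℂ → ℂ)
    (hH : ∀ z, ∃ φ : ℂ → ℂ, AnalyticAt ℂ φ z ∧ H =ᶠ[𝓝[≠] z] φ) :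
    ∃ h : ℂ → ℂ, Differentiable ℂ h ∧
      ∀ z (φ : ℂ → ℂ), AnalyticAt ℂ φ z → H =ᶠ[𝓝[≠] z] φ → h =ᶠ[𝓝 z] φ := by
  have key : ∀ z (φ : ℂ → ℂ), AnalyticAt ℂ φ z → H =ᶠ[𝓝[≠] z] φ →
      (fun w => limUnder (𝓝[≠] w) H) =ᶠ[𝓝 z] φ := by
    intro z φ hφ hHφ
    have h1 : ∀ᶠ w in 𝓝 z, H =ᶠ[𝓝[≠] w] φ := by
      rw [EventuallyEq, eventually_nhdsWithin_iff] at hHφ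
      have h2 := hHφ.eventually_nhds
      filter_upwards [h2] with w hw
      by_cases hwz : w = z
      · subst hwz
        rw [EventuallyEq, eventually_nhdsWithin_iff]; exact hw
      · rw [EventuallyEq, eventually_nhdsWithin_iff]
        filter_upwards [hw, isOpen_ne.mem_nhds hwz] with y hy hyz _ using hy hyz
    filter_upwards [h1, hφ.eventually_analyticAt] with w hw hφw
    apply Tendsto.limUnder_eq
    exact (hφw.continuousAt.tendsto.mono_left nhdsWithin_le_nhds).congr' hw.symm
  refine ⟨fun w => limUnder (𝓝[≠] w) H, fun z => ?_, key⟩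
  obtain ⟨φ, hφ, hHφ⟩ := hH z
  exact (hφ.congr (key z φ hφ hHφ).symm).differentiableAt

lemma cfz_local {f : ℂ → ℂ} (hf : Differentiable ℂ f) {k : ℕ} {a b : ℂ}
    (h0 : ∀ j < k, iteratedDeriv j f b = 0) (hk : iteratedDeriv k f b = a)
    (hk1 : iteratedDeriv (k + 1) f b = 0) :
    ∃ φ : ℂ → ℂ, AnalyticAt ℂ φ b ∧ ∀ᶠ z in 𝓝 b,
      f z = (z - b) ^ k * (a / (k.factorial : ℂ) + (z - b) ^ 2 * φ z) := by
  have hg : Differentiable ℂ (fun z => f (b + z)) := hf.comp (by fun_prop)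
  obtain ⟨F, hF, hFe⟩ := (hg.analyticAt 0).exists_eventuallyEq_sum_add_pow_mul (k + 2)
  refine ⟨fun z => F (z - b), ?_, ?_⟩
  · apply AnalyticAt.fun_comp (f := fun z => z - b)
    · simpa using hF
    · fun_prop
  · have ht : Tendsto (fun z => z - b) (𝓝 b) (𝓝 0) := by
      have : Continuous (fun z : ℂ => z - b) := by fun_prop
      simpa using this.tendsto b
    filter_upwards [ht.eventually hFe] with z hz
    rw [Finset.sum_range_succ, Finset.sum_range_succ, Finset.sum_eq_zero] at hz
    · simp only [iteratedDeriv_comp_const_add, add_zero, hk, hk1, smul_eq_mul, add_sub_cancel,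
        mul_zero, zero_add] at hz
      rw [hz]; ring
    · intro i hi
      simp only [iteratedDeriv_comp_const_add, add_zero, h0 i (Finset.mem_range.1 hi), smul_zero]

lemma cfz_finite {f : ℂ → ℂ} (hf : Differentiable ℂ f) (h0 : f 0 ≠ 0) (R : ℝ) :
    {z | f z = 0 ∧ ‖z‖ ≤ R}.Finite := by
  have han : AnalyticOnNhd ℂ f Set.univ := fun z _ => hf.analyticAt z
  have h1 := han.preimage_zero_mem_codiscrete h0
  have h2 := (mem_codiscrete'.1 h1)
  have h3 : {z | f z = 0 ∧ ‖z‖ ≤ R} ⊆ (f ⁻¹' {0}ᶜ)ᶜ := by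
    intro z hz; simp [hz.1]
  refine IsCompact.finite ?_ (h2.2.mono h3)
  have h4 : {z | f z = 0 ∧ ‖z‖ ≤ R} = (f ⁻¹' {0}) ∩ closedBall 0 R := by
    ext z; simp
  rw [h4]
  exact (isCompact_closedBall 0 R).inter_left (isClosed_singleton.preimage hf.continuous)

lemma cfz_factor {f : ℂ → ℂ} (hf : Differentiable ℂ f) {k : ℕ} (hk : 1 ≤ k) {α : ℂ} (hα : α ≠ 0)
    (h0 : f 0 ≠ 0)
    (hloc : ∀ b, f b = 0 → ∃ φ : ℂ → ℂ, AnalyticAt ℂ φ b ∧ ∀ᶠ z in 𝓝 b,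
      f z = (z - b) ^ k * (α + (z - b) ^ 2 * φ z))
    (S : Finset ℂ) (hS : ∀ b ∈ S, f b = 0) :
    ∃ u : ℂ → ℂ, Differentiable ℂ u ∧ (∀ z, f z = (∏ b ∈ S, (1 - z / b)) ^ k * u z) ∧
      ∀ b ∈ S, u b ≠ 0 := by
  classical
  have hb0 : ∀ b ∈ S, b ≠ 0 := fun b hb h => h0 (h ▸ hS b hb)
  have hne : ∀ z (T : Finset ℂ), T ⊆ S → z ∉ T → (∏ b ∈ T, (1 - z / b)) ^ k ≠ 0 := by
    intro z T hT hz
    refine pow_ne_zero _ (Finset.prod_ne_zero_iff.2 fun b hb h => hz ?_)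
    have := hb0 b (hT hb)
    have : z = b := by field_simp at h; linear_combination -h
    exact this ▸ hb
  have hP : ∀ T : Finset ℂ, Differentiable ℂ (fun z => (∏ b ∈ T, (1 - z / b)) ^ k) := by
    intro T; fun_prop
  have l1 : ∀ z ∉ S, AnalyticAt ℂ (fun z => f z / (∏ b ∈ S, (1 - z / b)) ^ k) z := fun z hz =>
    (hf.analyticAt z).fun_div ((hP S).analyticAt z) (hne z S subset_rfl hz)
  have l2 : ∀ b ∈ S, ∃ φ : ℂ → ℂ, AnalyticAt ℂ φ b ∧ φ b ≠ 0 ∧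
      (fun z => f z / (∏ b ∈ S, (1 - z / b)) ^ k) =ᶠ[𝓝[≠] b] φ := by
    intro b hb
    obtain ⟨φ, hφ, he⟩ := hloc b (hS b hb)
    have hb' := hb0 b hb
    refine ⟨fun z => (-b) ^ k * (α + (z - b) ^ 2 * φ z) / (∏ c ∈ S.erase b, (1 - z / c)) ^ k,
      ?_, ?_, ?_⟩
    · refine AnalyticAt.fun_div (by fun_prop) ((hP _).analyticAt b) (hne b _ (S.erase_subset b) (by simp))
    · refine div_ne_zero ?_ (hne b _ (S.erase_subset b) (by simp))
      simp [hα, hb']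
    · filter_upwards [he.filter_mono nhdsWithin_le_nhds, self_mem_nhdsWithin] with z hz hzb
      have hzb' : z - b ≠ 0 := sub_ne_zero.2 hzb
      rw [hz, ← Finset.mul_prod_erase S _ hb, mul_pow]
      have : (1 - z / b) = (z - b) * (-b)⁻¹ := by field_simp; ring
      rw [this, mul_pow, inv_pow]
      have h1 : (z - b) ^ k ≠ 0 := pow_ne_zero _ hzb'
      have h2 : (-b) ^ k ≠ 0 := pow_ne_zero _ (neg_ne_zero.2 hb')
      generalize (∏ c ∈ S.erase b, (1 - z / c)) ^ k = P
      generalize (-b) ^ k = Q at *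
      generalize (z - b) ^ k = Q at *
      rw [mul_assoc, mul_div_mul_left _ _ h1, inv_mul_eq_div, div_div_eq_mul_div, mul_comm]
  obtain ⟨u, hu, hue⟩ := cfz_glue (fun z => f z / (∏ b ∈ S, (1 - z / b)) ^ k) (fun z => by
    by_cases hz : z ∈ S
    · obtain ⟨φ, h1, -, h2⟩ := l2 z hz
      exact ⟨φ, h1, h2⟩
    · exact ⟨_, l1 z hz, EventuallyEq.rfl⟩)
  refine ⟨u, hu, fun z => ?_, fun b hb => ?_⟩
  · by_cases hz : z ∈ S
    · rw [hS z hz, Finset.prod_eq_zero hz, zero_pow (by omega), zero_mul]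
      rw [div_self (hb0 z hz), sub_self]
    · have := (hue z _ (l1 z hz) EventuallyEq.rfl).eq_of_nhds
      rw [this, mul_div_cancel₀ _ (hne z S subset_rfl hz)]
  · obtain ⟨φ, h1, h2, h3⟩ := l2 b hb
    rw [(hue b φ h1 h3).eq_of_nhds]; exact h2

lemma cfz_h {f : ℂ → ℂ} (hf : Differentiable ℂ f) {k : ℕ} (hk : 1 ≤ k) {α : ℂ} (hα : α ≠ 0)
    (hloc : ∀ b, f b = 0 → ∃ φ : ℂ → ℂ, AnalyticAt ℂ φ b ∧ ∀ᶠ z in 𝓝 b,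
      f z = (z - b) ^ k * (α + (z - b) ^ 2 * φ z)) :
    ∃ h : ℂ → ℂ, Differentiable ℂ h ∧ ∀ z, f z ≠ 0 →
      h z = deriv (fun z => logDeriv f z / k) z + (logDeriv f z / k) ^ 2 := by
  have hkc : (k : ℂ) ≠ 0 := by exact_mod_cast (by omega : k ≠ 0)
  have l1 : ∀ z, f z ≠ 0 → AnalyticAt ℂ
      (fun z => deriv (fun z => logDeriv f z / k) z + (logDeriv f z / k) ^ 2) z := by
    intro z hz
    have : AnalyticAt ℂ (fun z => logDeriv f z / k) z := by
      unfold logDeriv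
      exact (((hf.analyticAt z).deriv.div (hf.analyticAt z) hz).fun_div analyticAt_const hkc)
    exact this.deriv.fun_add (this.fun_pow 2)
  obtain ⟨h, hh, hhe⟩ := cfz_glue
    (fun z => deriv (fun z => logDeriv f z / k) z + (logDeriv f z / k) ^ 2) (fun b => by
      by_cases hb : f b = 0
      swap
      · exact ⟨_, l1 b hb, EventuallyEq.rfl⟩
      obtain ⟨φ, hφ, he⟩ := hloc b hb
      set w : ℂ → ℂ := fun z => α + (z - b) ^ 2 * φ z with hw
      have hwb : w b ≠ 0 := by simp [hw, hα]
      have hwa : AnalyticAt ℂ w b := by fun_prop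
      set ψ : ℂ → ℂ := fun z => (2 * φ z + (z - b) * deriv φ z) / (k * w z) with hψ
      have hψa : AnalyticAt ℂ ψ b := by
        refine AnalyticAt.fun_div ?_ (by fun_prop) (mul_ne_zero hkc hwb)
        have := hφ.deriv
        fun_prop
      refine ⟨fun z => 3 * ψ z + (z - b) * deriv ψ z + (z - b) ^ 2 * ψ z ^ 2, ?_, ?_⟩
      · have := hψa.deriv
        fun_prop
      · have e1 : ∀ᶠ z in 𝓝[≠] b, logDeriv f z / k = 1 / (z - b) + (z - b) * ψ z := by
          filter_upwards [he.eventually_nhds.filter_mono nhdsWithin_le_nhds, self_mem_nhdsWithin,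
            (hφ.eventually_analyticAt).filter_mono nhdsWithin_le_nhds,
            (hwa.continuousAt.eventually_ne hwb).filter_mono nhdsWithin_le_nhds]
            with z hz hzb hφz hwz
          have hzb' : z - b ≠ 0 := sub_ne_zero.2 hzb
          have hz' : f =ᶠ[𝓝 z] fun z => (z - b) ^ k * w z := hz
          have d1 : HasDerivAt (fun z => z - b) 1 z := (hasDerivAt_id z).sub_const b
          have d2 : HasDerivAt w (2 * (z - b) * φ z + (z - b) ^ 2 * deriv φ z) z := by
            have := ((d1.fun_pow 2).fun_mul hφz.differentiableAt.hasDerivAt).const_add α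
            exact this.congr_deriv (by norm_num)
          have d3 := (d1.fun_pow k).fun_mul d2
          rw [logDeriv_apply, hz'.deriv_eq, hz'.eq_of_nhds, d3.deriv, hψ]
          obtain ⟨m, rfl⟩ : ∃ m, k = m + 1 := ⟨k - 1, by omega⟩
          simp only [add_tsub_cancel_right, mul_one]
          field_simp
          ring
        have e2 := e1
        rw [eventually_nhdsWithin_iff] at e2
        filter_upwards [e1, e2.eventually_nhds.filter_mono nhdsWithin_le_nhds, self_mem_nhdsWithin,
          (hψa.eventually_analyticAt).filter_mono nhdsWithin_le_nhds] with z h1 h2 hzb hψz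
        have hzb' : z - b ≠ 0 := sub_ne_zero.2 hzb
        have h3 : (fun z => logDeriv f z / k) =ᶠ[𝓝 z] fun z => 1 / (z - b) + (z - b) * ψ z := by
          filter_upwards [h2, isOpen_ne.mem_nhds hzb] with y hy hyb using hy hyb
        have d1 : HasDerivAt (fun z => z - b) 1 z := (hasDerivAt_id z).sub_const b
        have d2 := ((hasDerivAt_const z (1:ℂ)).fun_div d1 hzb').fun_add
          (d1.fun_mul hψz.differentiableAt.hasDerivAt)
        rw [h3.deriv_eq, d2.deriv, h1]
        field_simp
        ring)
  exact ⟨h, hh, fun z hz => (hhe z _ (l1 z hz) EventuallyEq.rfl).eq_of_nhds⟩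

lemma cfz_int : Integrable ((Set.Ioc (-1:ℝ) 1).indicator (fun t : ℝ => |t| ^ (-(4/5) : ℝ))) := by
  rw [integrable_indicator_iff measurableSet_Ioc]
  have h := (intervalIntegral.intervalIntegrable_cpow' (a := -1) (b := 1)
    (r := ((-(4/5) : ℝ) : ℂ)) (by rw [Complex.ofReal_re]; norm_num)).norm
  rw [intervalIntegrable_iff_integrableOn_Ioc_of_le (by norm_num)] at h
  refine h.congr_fun (fun x _ => ?_) measurableSet_Ioc
  simp only
  rw [Complex.norm_cpow_real, Complex.norm_real, Real.norm_eq_abs]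

lemma cfz_radius1 : ∃ C : ℝ, 0 < C ∧ ∀ (S : Finset ℂ) (ρ : ℂ → ℝ),
    ∃ r ∈ Set.Icc (1:ℝ) 2, (∀ b ∈ S, r ≠ ρ b) ∧
      ∑ b ∈ S, |r - ρ b| ^ (-(4/5) : ℝ) ≤ C * S.card := by
  set F : ℝ → ℝ := (Set.Ioc (-1:ℝ) 1).indicator (fun t : ℝ => |t| ^ (-(4/5) : ℝ)) with hF
  have hFi : Integrable F := cfz_int
  have hF0 : ∀ t, 0 ≤ F t := fun t => Set.indicator_nonneg (fun x _ => by positivity) t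
  have hdom : ∀ t : ℝ, |t| ^ (-(4/5) : ℝ) ≤ 1 + F t := by
    intro t
    by_cases ht : t ∈ Set.Ioc (-1:ℝ) 1
    · rw [hF, Set.indicator_of_mem ht]; linarith
    · have : 1 ≤ |t| := by
        by_contra hc
        push Not at hc
        rw [abs_lt] at hc
        exact ht ⟨hc.1, hc.2.le⟩
      have := Real.rpow_le_one_of_one_le_of_nonpos this (by norm_num : (-(4/5) : ℝ) ≤ 0)
      linarith [hF0 t]
  refine ⟨1 + ∫ t, F t, by linarith [integral_nonneg (μ := volume) (f := F) (fun t => hF0 t)], fun S ρ => ?_⟩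
  have hIntg : ∀ b ∈ S, IntegrableOn (fun r => 1 + F (r - ρ b)) (Set.Icc 1 2) := by
    intro b _
    refine Integrable.add ?_ (hFi.comp_sub_right _).integrableOn
    exact integrableOn_const (by simp)
  have hsum : IntegrableOn (fun r => ∑ b ∈ S, (1 + F (r - ρ b))) (Set.Icc 1 2) :=
    integrable_finsetSum _ hIntg
  have hN : (volume.restrict (Set.Icc (1:ℝ) 2)) ((S.image ρ : Set ℝ) ∪ (Set.Icc (1:ℝ) 2)ᶜ) = 0 := by
    refine measure_union_null ?_ ?_
    · exact (Finset.finite_toSet _).measure_zero _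
    · rw [Measure.restrict_apply measurableSet_Icc.compl]; simp
  have hμ : volume.restrict (Set.Icc (1:ℝ) 2) ≠ 0 := by
    simp [Measure.restrict_eq_zero]
  obtain ⟨r, hr, hle⟩ := exists_notMem_null_le_average hμ hsum hN
  simp only [Set.mem_union, not_or, Set.mem_compl_iff, not_not] at hr
  refine ⟨r, hr.2, fun b hb h => hr.1 ?_, ?_⟩
  · rw [h]; exact_mod_cast Finset.mem_image_of_mem ρ hb
  · calc ∑ b ∈ S, |r - ρ b| ^ (-(4/5) : ℝ) ≤ ∑ b ∈ S, (1 + F (r - ρ b)) :=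
        Finset.sum_le_sum fun b _ => hdom _
      _ ≤ _ := hle
      _ = ∑ b ∈ S, ∫ x in Set.Icc 1 2, (1 + F (x - ρ b)) := by
        rw [average_eq, integral_finsetSum _ hIntg]
        norm_num [measureReal_def]
      _ ≤ ∑ b ∈ S, (1 + ∫ t, F t) := by
        refine Finset.sum_le_sum fun b hb => ?_
        rw [integral_add (integrable_const _) (hFi.comp_sub_right _).integrableOn]
        refine add_le_add ?_ ?_
        · norm_num [measureReal_def]
        · rw [← integral_sub_right_eq_self F (ρ b)]
          exact setIntegral_le_integral (hFi.comp_sub_right _) (Eventually.of_forall fun x => hF0 _)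
      _ = _ := by rw [Finset.sum_const, nsmul_eq_mul, mul_comm]

lemma cfz_radius : ∃ C : ℝ, 0 < C ∧ ∀ (S : Finset ℂ) (A : ℝ), 0 < A →
    ∃ r ∈ Set.Icc A (2 * A), (∀ b ∈ S, r ≠ ‖b‖) ∧
      ∑ b ∈ S, |r - ‖b‖|⁻¹ ≤ (C * S.card) ^ (5/4 : ℝ) / A := by
  obtain ⟨C, hC, h⟩ := cfz_radius1
  refine ⟨C, hC, fun S A hA => ?_⟩
  obtain ⟨s, hs, hne, hsum⟩ := h S (fun b => ‖b‖ / A)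
  refine ⟨A * s, ⟨by nlinarith [hs.1], by nlinarith [hs.2]⟩, fun b hb he => hne b hb ?_, ?_⟩
  · rw [← he]; field_simp
  set x : ℂ → ℝ := fun b => |s - ‖b‖ / A| ^ (-(4/5) : ℝ) with hx
  have hx0 : ∀ b, 0 ≤ x b := fun b => by positivity
  have e1 : ∀ b ∈ S, |A * s - ‖b‖|⁻¹ = x b ^ (5/4 : ℝ) / A := by
    intro b hb
    have : A * s - ‖b‖ = A * (s - ‖b‖ / A) := by field_simp
    rw [this, abs_mul, abs_of_pos hA, hx]
    simp only
    rw [← Real.rpow_mul (abs_nonneg _)]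
    norm_num [Real.rpow_neg_one]
    field_simp
  rw [Finset.sum_congr rfl e1, ← Finset.sum_div]
  gcongr
  set T := ∑ b ∈ S, x b with hT
  have hT0 : 0 ≤ T := Finset.sum_nonneg fun b _ => hx0 b
  calc ∑ b ∈ S, x b ^ (5/4 : ℝ) ≤ ∑ b ∈ S, x b * T ^ (1/4 : ℝ) := by
        refine Finset.sum_le_sum fun b hb => ?_
        have : x b ^ (5/4 : ℝ) = x b * x b ^ (1/4 : ℝ) := by
          have h1 := Real.rpow_add_of_nonneg (hx0 b) (by norm_num : (0:ℝ) ≤ 1) (by norm_num : (0:ℝ) ≤ 1/4)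
          rw [Real.rpow_one] at h1
          rw [← h1]; norm_num
        rw [this]
        have := Finset.single_le_sum (fun b _ => hx0 b) hb
        have := hx0 b
        gcongr
    _ = T ^ (5/4 : ℝ) := by
        rw [← Finset.sum_mul, ← hT]
        have h1 := Real.rpow_add_of_nonneg hT0 (by norm_num : (0:ℝ) ≤ 1) (by norm_num : (0:ℝ) ≤ 1/4)
        rw [Real.rpow_one] at h1
        rw [← h1]; norm_num
    _ ≤ _ := by gcongr

lemma cfz_zerofree {u : ℂ → ℂ} (hu : Differentiable ℂ u) {ρ M : ℝ} (hρ : 0 < ρ) (hM : 0 < M)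
    (hne : ∀ z, ‖z‖ < ρ → u z ≠ 0) (hb : ∀ z, ‖z‖ < ρ → ‖u z‖ ≤ ‖u 0‖ * Real.exp M)
    {z : ℂ} (hz : ‖z‖ ≤ ρ / 4) :
    ‖logDeriv u z‖ ≤ 8 * M / ρ ∧ ‖deriv (logDeriv u) z‖ ≤ 64 * M / ρ ^ 2 := by
  have hld : DifferentiableOn ℂ (logDeriv u) (ball 0 ρ) := by
    intro w hw
    have hw' : ‖w‖ < ρ := by simpa using hw
    exact (((hu.analyticAt w).deriv.div (hu.analyticAt w)
      (hne w hw')).differentiableAt).differentiableWithinAt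
  obtain ⟨L, hL0, hL⟩ := hld.isExactOn_ball.with_val_at 0 0
  have hLd : DifferentiableOn ℂ L (ball 0 ρ) := fun w hw =>
    (hL w hw).differentiableAt.differentiableWithinAt
  have hconst : ∀ w ∈ ball (0:ℂ) ρ, u w * Complex.exp (-L w) = u 0 := by
    intro w hw
    have hd : ∀ x ∈ ball (0:ℂ) ρ, HasDerivAt (fun w => u w * Complex.exp (-L w)) 0 x := by
      intro x hx
      have hx' : ‖x‖ < ρ := by simpa using hx
      have := (hu x).hasDerivAt.fun_mul (hL x hx).fun_neg.cexp
      refine this.congr_deriv ?_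
      rw [logDeriv_apply]
      have := hne x hx'
      field_simp
      ring
    have := (convex_ball (0:ℂ) ρ).is_const_of_fderivWithin_eq_zero (𝕜 := ℂ)
      (f := fun w => u w * Complex.exp (-L w))
      (fun x hx => (hd x hx).differentiableAt.differentiableWithinAt)
      (fun x hx => by
        rw [fderivWithin_of_isOpen isOpen_ball hx]
        have := (hd x hx).hasFDerivAt.fderiv
        rw [this]; ext; simp) hw (mem_ball_self hρ)
    simpa [hL0] using this
  have hre : Set.MapsTo L (ball 0 ρ) {z | z.re ≤ M} := by
    intro w hw
    have hw' : ‖w‖ < ρ := by simpa using hw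
    have h1 : u w = u 0 * Complex.exp (L w) := by
      rw [← hconst w hw, mul_assoc, ← Complex.exp_add]; simp
    have h2 := hb w hw'
    have h0 : 0 < ‖u 0‖ := norm_pos_iff.2 (hne 0 (by simpa using hρ))
    rw [h1, norm_mul, Complex.norm_exp] at h2
    exact Real.exp_le_exp.1 (le_of_mul_le_mul_left h2 h0)
  have hLb : ∀ w, ‖w‖ ≤ ρ / 2 → ‖L w‖ ≤ 2 * M := by
    intro w hw
    have h1 := Complex.borelCaratheodory_zero hM hLd hre hρ (z := w) (by simp; linarith) hL0
    refine h1.trans ?_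
    rw [div_le_iff₀ (by linarith)]
    nlinarith [norm_nonneg w]
  have hsub : closedBall z (ρ / 4) ⊆ ball 0 ρ := by
    intro w hw
    rw [mem_closedBall, dist_eq_norm] at hw
    have : ‖w‖ ≤ ‖w - z‖ + ‖z‖ := by simpa using norm_add_le (w - z) z
    simp; linarith
  have hdc : DiffContOnCl ℂ L (ball z (ρ / 4)) := by
    refine DifferentiableOn.diffContOnCl ?_
    exact hLd.mono ((closure_ball_subset_closedBall).trans hsub)
  have hs : ∀ w ∈ sphere z (ρ / 4), ‖L w‖ ≤ 2 * M := by
    intro w hw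
    apply hLb
    rw [mem_sphere, dist_eq_norm] at hw
    have : ‖w‖ ≤ ‖w - z‖ + ‖z‖ := by simpa using norm_add_le (w - z) z
    linarith
  have hzb : z ∈ ball (0:ℂ) ρ := by simp; linarith
  have e1 : deriv L =ᶠ[𝓝 z] logDeriv u := by
    filter_upwards [isOpen_ball.mem_nhds hzb] with w hw using (hL w hw).deriv
  constructor
  · have := Complex.norm_deriv_le_of_forall_mem_sphere_norm_le (by positivity) hdc hs
    rw [e1.eq_of_nhds] at this
    refine this.trans (le_of_eq ?_)
    field_simp; norm_num
  · have := Complex.norm_iteratedDeriv_le_of_forall_mem_sphere_norm_le 2 (by positivity) hdc hs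
    rw [iteratedDeriv_succ, iteratedDeriv_one, e1.deriv_eq] at this
    refine this.trans (le_of_eq ?_)
    simp [Nat.factorial]
    field_simp; norm_num

lemma cfz_const {h : ℂ → ℂ} (hh : Differentiable ℂ h) {C : ℝ}
    (hb : ∀ R : ℝ, 1 ≤ R → ∃ r ∈ Set.Icc (R / 24) (R / 12), ∀ z, ‖z‖ = r →
      ‖h z‖ ≤ C * R ^ (3/4 : ℝ)) : ∀ z, h z = h 0 := by
  have hd : ∀ w, deriv h w = 0 := by
    intro w
    rw [← norm_le_zero_iff]
    have hC0 : Tendsto (fun R : ℝ => 48 * C * R ^ (-(1/4) : ℝ)) atTop (𝓝 0) := by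
      simpa using (tendsto_rpow_neg_atTop (by norm_num : (0:ℝ) < 1/4)).const_mul (48 * C)
    refine ge_of_tendsto hC0 ?_
    filter_upwards [eventually_ge_atTop 1, eventually_ge_atTop (48 * ‖w‖)] with R hR hRw
    obtain ⟨r, ⟨hr1, hr2⟩, hr⟩ := hb R hR
    have hr0 : 0 < r := by linarith
    have hin : ∀ z, ‖z‖ ≤ r → ‖h z‖ ≤ C * R ^ (3/4 : ℝ) := by
      intro z hz
      refine Complex.norm_le_of_forall_mem_frontier_norm_le (U := ball 0 r) isBounded_ball
        hh.diffContOnCl (fun x hx => ?_) ?_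
      · rw [frontier_ball _ hr0.ne'] at hx
        exact hr x (by simpa using hx)
      · rw [closure_ball _ hr0.ne']; simpa using hz
    have h1 := Complex.norm_deriv_le_of_forall_mem_sphere_norm_le (c := w) (R := R / 48) (f := h)
      (by linarith) hh.diffContOnCl (C := C * R ^ (3/4 : ℝ)) (fun z hz => hin z (by
        rw [mem_sphere, dist_eq_norm] at hz
        have : ‖z‖ ≤ ‖z - w‖ + ‖w‖ := by simpa using norm_add_le (z - w) w
        linarith))
    refine h1.trans (le_of_eq ?_)
    have : R ^ (-(1/4) : ℝ) = R ^ (3/4 : ℝ) / R := by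
      rw [← Real.rpow_sub_one (by linarith)]; norm_num
    rw [this]; field_simp
  exact fun z => is_const_of_deriv_eq_zero hh hd z 0


lemma cfz_bound {f : ℂ → ℂ} (hf : Differentiable ℂ f) {k : ℕ} (hk : 1 ≤ k) {α : ℂ} (hα : α ≠ 0)
    (h0 : f 0 ≠ 0)
    (hloc : ∀ b, f b = 0 → ∃ φ : ℂ → ℂ, AnalyticAt ℂ φ b ∧ ∀ᶠ z in 𝓝 b,
      f z = (z - b) ^ k * (α + (z - b) ^ 2 * φ z))
    {K : ℝ} (hgr : ∀ R : ℝ, 1 ≤ R → ∀ z, ‖z‖ ≤ R → ‖f z‖ ≤ Real.exp (K * R ^ (11/10 : ℝ)))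
    {h : ℂ → ℂ} (hh : ∀ z, f z ≠ 0 →
      h z = deriv (fun z => logDeriv f z / k) z + (logDeriv f z / k) ^ 2) :
    ∃ C : ℝ, ∀ R : ℝ, 1 ≤ R → ∃ r ∈ Set.Icc (R / 24) (R / 12), ∀ z, ‖z‖ = r →
      ‖h z‖ ≤ C * R ^ (3/4 : ℝ) := by
  classical
  have hkc : (k : ℂ) ≠ 0 := by exact_mod_cast (by omega : k ≠ 0)
  obtain ⟨C, hC, hrad⟩ := cfz_radius
  have hf0 : 0 < ‖f 0‖ := norm_pos_iff.2 h0
  set K1 : ℝ := |K| + |Real.log ‖f 0‖| + 1 with hK1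
  have hK1pos : 0 < K1 := by positivity
  set C2 : ℝ := 24 * (C * (2 * K1)) ^ (5/4 : ℝ) with hC2
  refine ⟨C2 ^ 2 + 576 * K1 + (C2 + 24 * K1) ^ 2, fun R hR => ?_⟩
  have hR0 : 0 < R := by linarith
  set P : ℝ := R ^ (11/10 : ℝ) with hP
  have hP1 : 1 ≤ P := Real.one_le_rpow hR (by norm_num)
  set S : Finset ℂ := (cfz_finite hf h0 (R / 3)).toFinset with hS
  have hSm : ∀ b, b ∈ S ↔ f b = 0 ∧ ‖b‖ ≤ R / 3 := by intro b; simp [hS]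
  have hSb0 : ∀ b ∈ S, b ≠ 0 := fun b hb hb0 => h0 (hb0 ▸ ((hSm b).1 hb).1)
  obtain ⟨u, hu, hfu, huS⟩ := cfz_factor hf hk hα h0 hloc S (fun b hb => ((hSm b).1 hb).1)
  have hu0 : u 0 = f 0 := by rw [hfu 0]; simp
  have hune : ∀ z, ‖z‖ ≤ R / 3 → u z ≠ 0 := by
    intro z hz hzu
    have : f z = 0 := by rw [hfu, hzu, mul_zero]
    exact huS z ((hSm z).2 ⟨this, hz⟩) hzu
  -- maximum principle
  have humax : ∀ z, ‖z‖ ≤ R → ‖u z‖ ≤ Real.exp (K * P) / 2 ^ S.card := by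
    intro z hz
    refine Complex.norm_le_of_forall_mem_frontier_norm_le (U := ball 0 R) isBounded_ball
      hu.diffContOnCl (fun x hx => ?_) ?_
    · rw [frontier_ball _ hR0.ne'] at hx
      have hx' : ‖x‖ = R := by simpa using hx
      have h1 : (2:ℝ) ^ S.card ≤ ‖∏ b ∈ S, (1 - x / b)‖ := by
        rw [norm_prod, ← Finset.prod_const]
        refine Finset.prod_le_prod (fun _ _ => by norm_num) fun b hb => ?_
        have hb1 := ((hSm b).1 hb).2
        have hb2 : 0 < ‖b‖ := norm_pos_iff.2 (hSb0 b hb)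
        have h2 : (3:ℝ) ≤ ‖x / b‖ := by
          rw [norm_div, hx', le_div_iff₀ hb2]; linarith
        have h3 : ‖x / b‖ - ‖(1:ℂ)‖ ≤ ‖x / b - 1‖ := norm_sub_norm_le _ _
        rw [norm_one] at h3
        rw [norm_sub_rev]; linarith
      have h1' : (1:ℝ) ≤ 2 ^ S.card := one_le_pow₀ (by norm_num)
      have h2 : (2:ℝ) ^ S.card ≤ ‖∏ b ∈ S, (1 - x / b)‖ ^ k :=
        h1.trans (le_self_pow₀ (h1'.trans h1) (by omega))
      rw [le_div_iff₀ (by positivity)]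
      have h3 := hgr R hR x hx'.le
      rw [hfu x, norm_mul, norm_pow] at h3
      refine le_trans ?_ h3
      rw [mul_comm]
      gcongr
    · rw [closure_ball _ hR0.ne']; simpa using hz
  have hKP : K * P ≤ |K| * P := by gcongr; exact le_abs_self K
  have hlogP : |Real.log ‖f 0‖| ≤ |Real.log ‖f 0‖| * P := le_mul_of_one_le_right (abs_nonneg _) hP1
  have hlog : K * P - Real.log ‖f 0‖ ≤ K1 * P := by
    have := neg_abs_le (Real.log ‖f 0‖)
    have : K1 * P = |K| * P + |Real.log ‖f 0‖| * P + P := by rw [hK1]; ring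
    linarith
  have hn : (S.card : ℝ) ≤ 2 * K1 * P := by
    have h1 := humax 0 (by simpa using hR0.le)
    rw [hu0, le_div_iff₀ (by positivity)] at h1
    have h2 := Real.log_le_log (by positivity) h1
    rw [Real.log_mul hf0.ne' (by positivity), Real.log_exp, Real.log_pow] at h2
    have h3 := Real.log_two_gt_d9
    have h4 : (0:ℝ) ≤ S.card := Nat.cast_nonneg _
    nlinarith
  have huM : ∀ z, ‖z‖ < R / 3 → ‖u z‖ ≤ ‖u 0‖ * Real.exp (K1 * P) := by
    intro z hz
    have h1 := humax z (by linarith)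
    have h1' : (1:ℝ) ≤ 2 ^ S.card := one_le_pow₀ (by norm_num)
    calc ‖u z‖ ≤ Real.exp (K * P) := h1.trans (div_le_self (Real.exp_nonneg _) h1')
      _ = ‖f 0‖ * Real.exp (K * P - Real.log ‖f 0‖) := by
        rw [Real.exp_sub, Real.exp_log hf0]; field_simp
      _ ≤ _ := by rw [hu0]; gcongr
  obtain ⟨r, ⟨hr1, hr2⟩, hrne, hrs⟩ := hrad S (R / 24) (by positivity)
  refine ⟨r, ⟨hr1, by linarith⟩, fun z hz => ?_⟩
  have hzR : ‖z‖ ≤ (R / 3) / 4 := by linarith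
  have hfz : f z ≠ 0 := fun hfz => hrne z ((hSm z).2 ⟨hfz, by linarith⟩) hz.symm
  obtain ⟨hv1, hv2⟩ := cfz_zerofree hu (by positivity) (by positivity : 0 < K1 * P)
    (fun z hz => hune z hz.le) huM hzR
  -- formula for the logarithmic derivative
  have hld : ∀ w, f w ≠ 0 → logDeriv f w / k = ∑ b ∈ S, 1 / (w - b) + logDeriv u w / k := by
    intro w hw
    have hwS : ∀ b ∈ S, w - b ≠ 0 := fun b hb hwb =>
      hw ((sub_eq_zero.1 hwb) ▸ ((hSm b).1 hb).1)
    have hw1 : ∀ b ∈ S, 1 - w / b ≠ 0 := fun b hb hwb => hwS b hb (by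
      have := hSb0 b hb
      field_simp at hwb; linear_combination -hwb)
    have huw : u w ≠ 0 := fun h => hw (by rw [hfu, h, mul_zero])
    have hpw : ∏ b ∈ S, (1 - w / b) ≠ 0 := Finset.prod_ne_zero_iff.2 hw1
    have e : f = fun z => (∏ b ∈ S, (1 - z / b)) ^ k * u z := funext hfu
    rw [e, logDeriv_mul (f := fun z => (∏ b ∈ S, (1 - z / b)) ^ k) (g := u) w (pow_ne_zero _ hpw) huw (by fun_prop) (hu w)]
    rw [logDeriv_fun_pow (by fun_prop), logDeriv_prod (f := fun (b : ℂ) (z : ℂ) => 1 - z / b)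
      (hf := hw1) (hd := fun b _ => by fun_prop)]
    rw [add_div, mul_div_cancel_left₀ _ hkc]
    congr 1
    refine Finset.sum_congr rfl fun b hb => ?_
    have d : HasDerivAt (fun z : ℂ => 1 - z / b) (-(1 / b)) w := by
      simpa using ((hasDerivAt_id w).div_const b).const_sub 1
    rw [logDeriv_apply, d.deriv]
    have h1 := hSb0 b hb
    have h2 := hw1 b hb
    have h3 := hwS b hb
    have : 1 - w / b = -(w - b) / b := by field_simp; ring
    rw [this]
    field_simp
  have hzS : ∀ b ∈ S, z - b ≠ 0 := fun b hb hzb =>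
    hfz ((sub_eq_zero.1 hzb) ▸ ((hSm b).1 hb).1)
  have hev : (fun z => logDeriv f z / k) =ᶠ[𝓝 z]
      fun w => ∑ b ∈ S, 1 / (w - b) + logDeriv u w / k := by
    filter_upwards [hf.continuous.continuousAt.eventually_ne hfz] with w hw using hld w hw
  have huz : u z ≠ 0 := hune z (by linarith)
  have hder : HasDerivAt (fun w => ∑ b ∈ S, 1 / (w - b) + logDeriv u w / k)
      (∑ b ∈ S, -1 / (z - b) ^ 2 + deriv (logDeriv u) z / k) z := by
    refine HasDerivAt.fun_add ?_ ?_
    · refine HasDerivAt.fun_sum fun b hb => ?_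
      have := (hasDerivAt_const z (1:ℂ)).fun_div ((hasDerivAt_id z).sub_const b) (hzS b hb)
      simpa using this
    · refine HasDerivAt.div_const ?_ _
      exact ((hu.analyticAt z).deriv.div (hu.analyticAt z) huz).differentiableAt.hasDerivAt
  set s : ℝ := ∑ b ∈ S, |r - ‖b‖|⁻¹ with hs
  have hs0 : 0 ≤ s := Finset.sum_nonneg fun _ _ => by positivity
  have hb1 : ∀ b ∈ S, ‖z - b‖⁻¹ ≤ |r - ‖b‖|⁻¹ := by
    intro b hb
    have h1 : 0 < |r - ‖b‖| := abs_pos.2 (sub_ne_zero.2 (hrne b hb))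
    have h2 : |r - ‖b‖| ≤ ‖z - b‖ := by rw [← hz]; exact abs_norm_sub_norm_le z b
    gcongr
  have hσ : ‖∑ b ∈ S, 1 / (z - b)‖ ≤ s := by
    refine (norm_sum_le _ _).trans (Finset.sum_le_sum fun b hb => ?_)
    simpa using hb1 b hb
  have hσ2 : ‖∑ b ∈ S, -1 / (z - b) ^ 2‖ ≤ s ^ 2 := by
    refine (norm_sum_le _ _).trans ?_
    calc ∑ b ∈ S, ‖-1 / (z - b) ^ 2‖ ≤ ∑ b ∈ S, |r - ‖b‖|⁻¹ * s := by
          refine Finset.sum_le_sum fun b hb => ?_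
          have h1 := hb1 b hb
          have h2 : |r - ‖b‖|⁻¹ ≤ s :=
            Finset.single_le_sum (f := fun b => |r - ‖b‖|⁻¹) (fun _ _ => by positivity) hb
          have h3 : ‖-1 / (z - b) ^ 2‖ = ‖z - b‖⁻¹ * ‖z - b‖⁻¹ := by
            simp [sq]
          rw [h3]
          have := h1.trans h2
          gcongr
      _ = s ^ 2 := by rw [← Finset.sum_mul, sq]
  have hk1 : (1:ℝ) ≤ k := by exact_mod_cast hk
  have hdivk : ∀ w : ℂ, ‖w / k‖ ≤ ‖w‖ := by
    intro w
    rw [norm_div, Complex.norm_natCast]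
    exact div_le_self (norm_nonneg _) hk1
  -- numerical bounds
  set Q : ℝ := R ^ (3/8 : ℝ) with hQ
  have hQ0 : 0 ≤ Q := by positivity
  have hQ2 : Q ^ 2 = R ^ (3/4 : ℝ) := by
    rw [hQ, ← Real.rpow_natCast, ← Real.rpow_mul hR0.le]; norm_num
  have hPR : P / R ≤ Q := by
    rw [hP, ← Real.rpow_sub_one hR0.ne']
    exact Real.rpow_le_rpow_of_exponent_le hR (by norm_num)
  have hsQ : s ≤ C2 * Q := by
    refine hrs.trans ?_
    calc (C * (S.card : ℝ)) ^ (5/4 : ℝ) / (R / 24)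
        ≤ (C * (2 * K1) * P) ^ (5/4 : ℝ) / (R / 24) := by
          refine div_le_div_of_nonneg_right (Real.rpow_le_rpow
            (mul_nonneg hC.le (Nat.cast_nonneg _)) ?_ (by norm_num))
            (by positivity)
          rw [mul_assoc]
          exact mul_le_mul_of_nonneg_left hn hC.le
      _ = C2 * Q := by
          rw [Real.mul_rpow (by positivity) (by positivity), hC2, hQ, hP, ← Real.rpow_mul hR0.le]
          have : R ^ (3/8 : ℝ) = R ^ (11/10 * (5/4) : ℝ) / R := by
            rw [← Real.rpow_sub_one hR0.ne']; norm_num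
          rw [this]; field_simp
  have hvQ : ‖logDeriv u z‖ ≤ 24 * K1 * Q := by
    refine hv1.trans ?_
    calc 8 * (K1 * P) / (R / 3) = 24 * K1 * (P / R) := by field_simp; norm_num
      _ ≤ _ := by gcongr
  have hdQ : ‖deriv (logDeriv u) z‖ ≤ 576 * K1 * Q ^ 2 := by
    refine hv2.trans ?_
    have hPR0 : 0 ≤ P / R := by positivity
    have hPR2 : P / R ^ 2 ≤ Q ^ 2 := by
      have : P / R ^ 2 ≤ (P / R) ^ 2 := by
        rw [div_pow]; gcongr; nlinarith
      refine this.trans (by gcongr)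
    calc 64 * (K1 * P) / (R / 3) ^ 2 = 576 * K1 * (P / R ^ 2) := by field_simp; norm_num
      _ ≤ _ := by gcongr
  rw [hh z hfz, hev.deriv_eq, hder.deriv, hev.eq_of_nhds]
  calc _ ≤ ‖∑ b ∈ S, -1 / (z - b) ^ 2‖ + ‖deriv (logDeriv u) z / k‖ +
        (‖∑ b ∈ S, 1 / (z - b)‖ + ‖logDeriv u z / k‖) ^ 2 := by
        refine (norm_add_le _ _).trans (add_le_add (norm_add_le _ _) ?_)
        rw [norm_pow]
        gcongr
        exact norm_add_le _ _
    _ ≤ (C2 * Q) ^ 2 + 576 * K1 * Q ^ 2 + (C2 * Q + 24 * K1 * Q) ^ 2 := by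
        have i1 := hσ.trans hsQ
        have i2 := (hdivk (logDeriv u z)).trans hvQ
        have i3 := (hdivk (deriv (logDeriv u) z)).trans hdQ
        have i4 : ‖∑ b ∈ S, -1 / (z - b) ^ 2‖ ≤ (C2 * Q) ^ 2 := hσ2.trans (by gcongr)
        gcongr
    _ = _ := by rw [← hQ2]; ring

lemma cfz_riccati0 {f : ℂ → ℂ} (hf : Differentiable ℂ f) {k : ℕ} (hk : 1 ≤ k) {α : ℂ} (hα : α ≠ 0)
    (h0 : f 0 ≠ 0)
    (hloc : ∀ b, f b = 0 → ∃ φ : ℂ → ℂ, AnalyticAt ℂ φ b ∧ ∀ᶠ z in 𝓝 b,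
      f z = (z - b) ^ k * (α + (z - b) ^ 2 * φ z))
    {K : ℝ} (hgr : ∀ R : ℝ, 1 ≤ R → ∀ z, ‖z‖ ≤ R → ‖f z‖ ≤ Real.exp (K * R ^ (11/10 : ℝ))) :
    ∃ c : ℂ, ∀ z, f z ≠ 0 →
      deriv (fun z => logDeriv f z / k) z + (logDeriv f z / k) ^ 2 = c := by
  obtain ⟨h, hh, hhe⟩ := cfz_h hf hk hα hloc
  obtain ⟨C, hC⟩ := cfz_bound hf hk hα h0 hloc hgr hhe
  have := cfz_const hh hC
  exact ⟨h 0, fun z hz => by rw [← hhe z hz, this z]⟩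


lemma cfz_ballconst {g : ℂ → ℂ} {ρ : ℝ} (hρ : 0 < ρ)
    (hd : ∀ x ∈ ball (0:ℂ) ρ, HasDerivAt g 0 x) : ∀ w ∈ ball (0:ℂ) ρ, g w = g 0 := by
  intro w hw
  exact (convex_ball (0:ℂ) ρ).is_const_of_fderivWithin_eq_zero (𝕜 := ℂ) (f := g)
      (fun x hx => (hd x hx).differentiableAt.differentiableWithinAt)
      (fun x hx => by
        rw [fderivWithin_of_isOpen isOpen_ball hx]
        have := (hd x hx).hasFDerivAt.fderiv
        rw [this]; ext; simp) hw (mem_ball_self hρ)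

lemma cfz_solve {f : ℂ → ℂ} (hf : Differentiable ℂ f) {k : ℕ} (hk : 1 ≤ k) (h0 : f 0 ≠ 0) {c : ℂ}
    (hc : ∀ z, f z ≠ 0 →
      deriv (fun z => logDeriv f z / k) z + (logDeriv f z / k) ^ 2 = c) :
    ∃ l A B : ℂ, (l ≠ 0 ∧ ∀ z, f z = (A * Complex.exp (l * z) + B * Complex.exp (-(l * z))) ^ k) ∨
      ∀ z, f z = (A + B * z) ^ k := by
  have hkc : (k : ℂ) ≠ 0 := by exact_mod_cast (by omega : k ≠ 0)
  obtain ⟨w0, hw0⟩ := IsAlgClosed.exists_pow_nat_eq (f 0) (by omega : 0 < k)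
  obtain ⟨l, hl⟩ := IsAlgClosed.exists_pow_nat_eq c (by omega : 0 < 2)
  obtain ⟨ρ, hρ, hball⟩ : ∃ ρ > 0, ∀ z ∈ ball (0:ℂ) ρ, f z / f 0 ∈ Complex.slitPlane := by
    have hcont : ContinuousAt (fun z => f z / f 0) 0 := by
      exact (hf.continuous.div_const _).continuousAt
    have := hcont.eventually_mem (Complex.isOpen_slitPlane.mem_nhds (by simp [h0]))
    exact Metric.eventually_nhds_iff_ball.1 this
  have hfne : ∀ z ∈ ball (0:ℂ) ρ, f z ≠ 0 := by
    intro z hz h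
    have := Complex.slitPlane_ne_zero (hball z hz)
    simp [h] at this
  set w : ℂ → ℂ := fun z => w0 * Complex.exp (Complex.log (f z / f 0) / k) with hw
  set q : ℂ → ℂ := fun z => logDeriv f z / k with hq
  have hwk : ∀ z ∈ ball (0:ℂ) ρ, w z ^ k = f z := by
    intro z hz
    rw [hw]
    simp only
    rw [mul_pow, hw0, ← Complex.exp_nat_mul, mul_div_cancel₀ _ hkc,
      Complex.exp_log (div_ne_zero (hfne z hz) h0)]
    field_simp
  have hdw : ∀ z ∈ ball (0:ℂ) ρ, HasDerivAt w (w z * q z) z := by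
    intro z hz
    have h1 := (((((hf z).hasDerivAt.div_const (f 0)).clog (hball z hz)).div_const
      (k:ℂ)).cexp).const_mul w0
    refine h1.congr_deriv ?_
    have := hfne z hz
    simp only [hw, hq, logDeriv_apply]
    field_simp
  have hdq : ∀ z ∈ ball (0:ℂ) ρ, HasDerivAt q (c - q z ^ 2) z := by
    intro z hz
    have hfz := hfne z hz
    have h1 : DifferentiableAt ℂ q z :=
      (((hf.analyticAt z).deriv.div (hf.analyticAt z) hfz).fun_div analyticAt_const
        hkc).differentiableAt
    refine h1.hasDerivAt.congr_deriv ?_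
    rw [← hc z hfz]; ring
  have hdwq : ∀ z ∈ ball (0:ℂ) ρ, HasDerivAt (fun z => w z * q z) (c * w z) z := by
    intro z hz
    refine ((hdw z hz).fun_mul (hdq z hz)).congr_deriv ?_
    ring
  have finish : ∀ g : ℂ → ℂ, Differentiable ℂ g → (∀ z ∈ ball (0:ℂ) ρ, w z = g z) →
      ∀ z, f z = g z ^ k := by
    intro g hg hwg z
    have h1 : f =ᶠ[𝓝 0] fun z => g z ^ k := by
      filter_upwards [isOpen_ball.mem_nhds (mem_ball_self hρ)] with z hz
      rw [← hwk z hz, hwg z hz]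
    have h2 := AnalyticOnNhd.eq_of_eventuallyEq (z₀ := 0) (fun z _ => hf.analyticAt z)
      (fun z _ => (hg.fun_pow k).analyticAt z) h1
    exact congrFun h2 z
  by_cases hl0 : l = 0
  · have hc0 : c = 0 := by rw [← hl, hl0]; simp
    have k1 := cfz_ballconst hρ (g := fun z => w z * q z) (fun z hz => by
      simpa [hc0] using hdwq z hz)
    have k2 := cfz_ballconst hρ (g := fun z => w z - w z * q z * z) (fun z hz => by
      refine ((hdw z hz).fun_sub ((hdwq z hz).fun_mul (hasDerivAt_id' z))).congr_deriv ?_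
      rw [hc0]; ring)
    refine ⟨0, w 0, w 0 * q 0, Or.inr (finish _ (by fun_prop) fun z hz => ?_)⟩
    have e1 := k1 z hz
    have e2 := k2 z hz
    rw [e1] at e2
    linear_combination e2
  · have dE : ∀ z, HasDerivAt (fun z => Complex.exp (l * z)) (Complex.exp (l * z) * l) z := fun z => by
      simpa using ((hasDerivAt_id' z).const_mul l).cexp
    have dE' : ∀ z, HasDerivAt (fun z => Complex.exp (-(l * z))) (Complex.exp (-(l * z)) * -l) z :=
      fun z => by simpa using ((hasDerivAt_id' z).const_mul l).fun_neg.cexp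
    have k1 := cfz_ballconst hρ (g := fun z => (w z * q z - l * w z) * Complex.exp (l * z))
      (fun z hz => by
        refine (((hdwq z hz).fun_sub ((hdw z hz).const_mul l)).fun_mul (dE z)).congr_deriv ?_
        rw [← hl]; ring)
    have k2 := cfz_ballconst hρ (g := fun z => (w z * q z + l * w z) * Complex.exp (-(l * z)))
      (fun z hz => by
        refine (((hdwq z hz).fun_add ((hdw z hz).const_mul l)).fun_mul (dE' z)).congr_deriv ?_
        rw [← hl]; ring)
    refine ⟨l, (w 0 * q 0 + l * w 0) / (2 * l), -(w 0 * q 0 - l * w 0) / (2 * l),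
      Or.inl ⟨hl0, finish _ (by fun_prop) fun z hz => ?_⟩⟩
    have e1 := k1 z hz
    have e2 := k2 z hz
    simp only [mul_zero, Complex.exp_zero, mul_one, neg_zero] at e1 e2
    have hE : Complex.exp (l * z) * Complex.exp (-(l * z)) = 1 := by
      rw [← Complex.exp_add]; simp
    rw [← e1, ← e2]
    field_simp
    linear_combination (-2 * l * w z) * hE


noncomputable def cfzC (k j : ℕ) : ℂ :=
  (1 / (2 * Complex.I)) ^ k * (k.choose j : ℂ) * (-1) ^ (k - j)

noncomputable def cfzS (k n : ℕ) (x : ℂ) : ℂ :=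
  ∑ j ∈ Finset.range (k + 1), cfzC k j * (Complex.I * (2 * j - k)) ^ n *
    Complex.exp (Complex.I * (2 * j - k) * x)

noncomputable def cfzQ (k n : ℕ) : Polynomial ℂ :=
  ∑ j ∈ Finset.range (k + 1), Polynomial.monomial j (cfzC k j * (Complex.I * (2 * j - k)) ^ n)

lemma cfzS_zero (k : ℕ) (x : ℂ) : cfzS k 0 x = Complex.sin x ^ k := by
  have h : Complex.sin x = (1 / (2 * Complex.I)) *
      (Complex.exp (Complex.I * x) + -Complex.exp (-(Complex.I * x))) := by
    rw [Complex.sin]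
    rw [show -x * Complex.I = -(Complex.I * x) by ring, show x * Complex.I = Complex.I * x by ring]
    field_simp
    rw [Complex.I_sq]; ring
  rw [h, mul_pow, add_pow, Finset.mul_sum, cfzS]
  refine Finset.sum_congr rfl fun j hj => ?_
  have hj' : j ≤ k := by simpa [Nat.lt_succ_iff] using hj
  rw [neg_pow (Complex.exp _), ← Complex.exp_nat_mul, ← Complex.exp_nat_mul, cfzC]
  have : Complex.exp (Complex.I * (2 * j - k) * x) =
      Complex.exp (j * (Complex.I * x)) * Complex.exp (((k - j : ℕ) : ℂ) * -(Complex.I * x)) := by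
    rw [← Complex.exp_add]; congr 1; push_cast [hj']; ring
  rw [this]; ring

lemma cfzS_deriv (k n : ℕ) (x : ℂ) : HasDerivAt (cfzS k n) (cfzS k (n + 1) x) x := by
  unfold cfzS
  refine HasDerivAt.fun_sum fun j _ => ?_
  refine ((((hasDerivAt_id' x).const_mul (Complex.I * (2 * j - k))).cexp).const_mul _).congr_deriv ?_
  ring

lemma cfzS_iter (k n : ℕ) : iteratedDeriv n (fun x => Complex.sin x ^ k) = cfzS k n := by
  induction n with
  | zero => funext x; simp [cfzS_zero]
  | succ n ih => rw [iteratedDeriv_succ, ih]; funext x; exact (cfzS_deriv k n x).deriv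

lemma cfzS_Q (k n : ℕ) (x : ℂ) : cfzS k n x = Complex.exp (-(Complex.I * k * x)) *
    (cfzQ k n).eval (Complex.exp (2 * Complex.I * x)) := by
  rw [cfzS, cfzQ, Polynomial.eval_finsetSum, Finset.mul_sum]
  refine Finset.sum_congr rfl fun j _ => ?_
  rw [Polynomial.eval_monomial, ← Complex.exp_nat_mul, mul_left_comm, ← Complex.exp_add]
  congr 2; ring

lemma cfzQ_deg (k n : ℕ) : (cfzQ k n).natDegree ≤ k := by
  unfold cfzQ
  refine Polynomial.natDegree_sum_le_of_forall_le _ _ fun j hj => ?_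
  have hj' : j ≤ k := by simpa [Nat.lt_succ_iff] using hj
  exact (Polynomial.natDegree_monomial_le _).trans hj'

lemma cfzQ_ne (k n : ℕ) (hk : 1 ≤ k) : cfzQ k n ≠ 0 := by
  intro h
  have h1 : (cfzQ k n).coeff k = 0 := by rw [h]; simp
  have hk0 : (k : ℂ) ≠ 0 := by exact_mod_cast (by omega : k ≠ 0)
  rw [cfzQ, Polynomial.finsetSum_coeff] at h1
  simp only [Polynomial.coeff_monomial] at h1
  rw [Finset.sum_ite_eq' ] at h1
  have : (2 * (k:ℂ) - k) = k := by ring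
  simp [cfzC, this, hk0] at h1

/-- if `cfzS k n` has `k` distinct zeros, all its zeros are simple. -/
lemma cfzS_simple (k n : ℕ) (hk : 1 ≤ k) (r : ℕ → ℝ)
    (hr : ∀ i < k, ∀ j < k, i ≠ j → Complex.exp (2 * Complex.I * r i) ≠ Complex.exp (2 * Complex.I * r j))
    (hz : ∀ i < k, cfzS k n (r i) = 0) (x : ℂ) (hx : cfzS k n x = 0) : cfzS k (n + 1) x ≠ 0 := by
  intro hx1
  set Q := cfzQ k n with hQ
  have hQ0 : Q ≠ 0 := cfzQ_ne k n hk
  set s := Complex.exp (2 * Complex.I * x) with hs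
  have roots : ∀ y, cfzS k n y = 0 → Q.IsRoot (Complex.exp (2 * Complex.I * y)) := by
    intro y hy
    rw [cfzS_Q] at hy
    exact (mul_eq_zero.1 hy).resolve_left (Complex.exp_ne_zero _)
  have hd : Q.derivative.eval s = 0 := by
    have d0 : HasDerivAt (fun y => Q.eval (Complex.exp (2 * Complex.I * y)))
        (Q.derivative.eval s * (Complex.exp (2 * Complex.I * x) * (2 * Complex.I * 1))) x :=
      HasDerivAt.comp (h₂ := fun w => Q.eval w) x (Q.hasDerivAt s) (((hasDerivAt_id' x).const_mul (2 * Complex.I)).cexp)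
    have d1 := (((hasDerivAt_id' x).const_mul (Complex.I * (k:ℂ))).fun_neg.cexp).fun_mul d0
    have d2 := cfzS_deriv k n x
    rw [show cfzS k n = _ from funext (cfzS_Q k n)] at d2
    have := d1.unique d2
    rw [hx1] at this
    have hr0 : Q.eval s = 0 := roots x hx
    simp only [← hs] at this
    rw [hr0] at this
    simpa [Complex.exp_ne_zero, hs] using this
  have hroot : Q.IsRoot s := roots x hx
  obtain ⟨P, hP⟩ := Polynomial.dvd_iff_isRoot.2 hroot
  have hPs : P.IsRoot s := by
    rw [hP] at hd
    simpa using hd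
  have hP0 : P ≠ 0 := by rintro rfl; simp at hP; exact hQ0 hP
  have hdeg : P.natDegree + 1 ≤ k := by
    have := cfzQ_deg k n
    rw [← hQ, hP, Polynomial.natDegree_mul (Polynomial.X_sub_C_ne_zero s) hP0,
      Polynomial.natDegree_X_sub_C] at this
    omega
  set T := (Finset.range k).image (fun i => Complex.exp (2 * Complex.I * r i)) with hT
  have hc : T.card = k := by
    rw [hT, Finset.card_image_of_injOn, Finset.card_range]
    intro i hi j hj h
    by_contra hne
    exact hr i (by simpa using hi) j (by simpa using hj) hne h
  have hsub : T ⊆ P.roots.toFinset := by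
    intro t ht
    obtain ⟨i, hi, rfl⟩ := Finset.mem_image.1 ht
    have h1 := roots _ (hz i (by simpa using hi))
    rw [Multiset.mem_toFinset, Polynomial.mem_roots hP0]
    by_cases h : Complex.exp (2 * Complex.I * r i) = s
    · rw [h]; exact hPs
    · rw [hP, Polynomial.root_mul] at h1
      refine h1.resolve_left ?_
      simpa [sub_eq_zero] using h
  have := (Finset.card_le_card hsub).trans ((Multiset.toFinset_card_le _).trans (Polynomial.card_roots' P))
  omega

lemma cfzS_real (k n : ℕ) : ∀ x : ℝ, (cfzS k n x).im = 0 := by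
  induction n with
  | zero =>
    intro x
    rw [cfzS_zero, ← Complex.ofReal_sin, ← Complex.ofReal_pow, Complex.ofReal_im]
  | succ n ih =>
    intro x
    have h := ((cfzS_deriv k n x).const_mul (-Complex.I)).real_of_complex
    have e : (fun y : ℝ => (-Complex.I * cfzS k n y).re) = fun _ => 0 := by
      funext y; simp [ih]
    rw [e] at h
    have := h.unique (hasDerivAt_const x 0)
    simpa using this

noncomputable def cfzG (k n : ℕ) (x : ℝ) : ℝ := (cfzS k n x).re

lemma cfzG_coe (k n : ℕ) (x : ℝ) : (cfzG k n x : ℂ) = cfzS k n x := by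
  apply Complex.ext <;> simp [cfzG, cfzS_real]

lemma cfzG_deriv (k n : ℕ) (x : ℝ) : HasDerivAt (cfzG k n) (cfzG k (n + 1) x) x :=
  (cfzS_deriv k n x).real_of_complex

lemma cfz_rolle {g g' : ℝ → ℝ} (hg : ∀ x, HasDerivAt g (g' x) x) {u v : ℝ} (h : u < v)
    (hu : g u = 0) (hv : g v = 0) : ∃ q, u < q ∧ q < v ∧ g' q = 0 := by
  obtain ⟨q, hq, h0⟩ := exists_hasDerivAt_eq_zero h
    (fun x _ => (hg x).continuousAt.continuousWithinAt) (hu.trans hv.symm) (fun x _ => hg x)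
  exact ⟨q, hq.1, hq.2, h0⟩

lemma cfz_count {G : ℕ → ℝ → ℝ} (hG : ∀ n x, HasDerivAt (G n) (G (n + 1) x) x) (k : ℕ) {b : ℝ}
    (hb : 0 < b) (h0 : ∀ n < k, G n 0 = 0) (h1 : ∀ n < k, G n b = 0) (n : ℕ) (hn : n ≤ k) :
    ∃ p : ℕ → ℝ, (∀ i ≤ n, p i < p (i + 1)) ∧ p 0 = 0 ∧ p (n + 1) = b ∧
      ∀ i, 1 ≤ i → i ≤ n → G n (p i) = 0 := by
  induction n with
  | zero => exact ⟨fun i => i * b, by intro i hi; push_cast; linarith, by simp, by simp,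
      by intro i h h'; omega⟩
  | succ n ih =>
    obtain ⟨p, hp, hp0, hpn, hpz⟩ := ih (by omega)
    have hz : ∀ i ≤ n + 1, G n (p i) = 0 := by
      intro i hi
      rcases Nat.eq_zero_or_pos i with rfl | hi0
      · rw [hp0]; exact h0 n (by omega)
      · rcases Nat.lt_or_ge i (n + 1) with h | h
        · exact hpz i hi0 (by omega)
        · rw [show i = n + 1 by omega, hpn]; exact h1 n (by omega)
    have hq : ∀ i, ∃ q, i ≤ n → p i < q ∧ q < p (i + 1) ∧ G (n + 1) q = 0 := by
      intro i
      by_cases hi : i ≤ n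
      · obtain ⟨q, hq⟩ := cfz_rolle (hG n) (hp i hi) (hz i (by omega)) (hz (i + 1) (by omega))
        exact ⟨q, fun _ => hq⟩
      · exact ⟨0, fun h => absurd h hi⟩
    choose q hq using hq
    refine ⟨fun i => if i = 0 then 0 else if i ≤ n + 1 then q (i - 1) else b, ?_, by simp, by simp, ?_⟩
    · intro i hi
      rcases Nat.eq_zero_or_pos i with rfl | hi0
      · have := (hq 0 (by omega)).1
        simpa [hp0] using this
      · obtain ⟨j, rfl⟩ : ∃ j, i = j + 1 := ⟨i - 1, by omega⟩
        rcases Nat.lt_or_ge j n with h | h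
        · have e1 := (hq j (by omega)).2.1
          have e2 := (hq (j + 1) (by omega)).1
          simp [h, hi]
          linarith
        · have hj : j = n := by omega
          subst hj
          have e1 := (hq j (by omega)).2.1
          simpa [hpn] using e1
    · intro i hi1 hi2
      obtain ⟨j, rfl⟩ : ∃ j, i = j + 1 := ⟨i - 1, by omega⟩
      simp [hi2]
      exact (hq j (by omega)).2.2

lemma cfz_count' {G : ℕ → ℝ → ℝ} (hG : ∀ n x, HasDerivAt (G n) (G (n + 1) x) x) (k : ℕ) {b : ℝ}
    (hb : 0 < b) (h0 : ∀ n < k, G n 0 = 0) (h1 : ∀ n < k, G n b = 0) (h2 : G (k + 1) 0 = 0) :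
    ∃ r : ℕ → ℝ, (∀ i < k, ∀ j < k, i < j → r i < r j) ∧ (∀ i < k, 0 ≤ r i ∧ r i < b) ∧
      ∀ i < k, G (k + 1) (r i) = 0 := by
  obtain ⟨p, hp, hp0, hpn, hpz⟩ := cfz_count hG k hb h0 h1 k le_rfl
  have hq : ∀ i, ∃ q, 1 ≤ i → i < k → p i < q ∧ q < p (i + 1) ∧ G (k + 1) q = 0 := by
    intro i
    by_cases hi : 1 ≤ i ∧ i < k
    · obtain ⟨q, hq⟩ := cfz_rolle (hG k) (hp i hi.2.le) (hpz i hi.1 hi.2.le)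
        (hpz (i + 1) (by omega) (by omega))
      exact ⟨q, fun _ _ => hq⟩
    · exact ⟨0, fun h h' => absurd ⟨h, h'⟩ hi⟩
  choose q hq using hq
  have mono : ∀ i j, i ≤ j → j ≤ k + 1 → p i ≤ p j := by
    intro i j hij
    induction j, hij using Nat.le_induction with
    | base => intro _; exact le_rfl
    | succ j hj ih => intro h; exact (ih (by omega)).trans (hp j (by omega)).le
  refine ⟨fun i => if i = 0 then 0 else q i, ?_, ?_, ?_⟩
  · intro i hi j hj hij
    have e2 := (hq j (by omega) hj).1
    have hj0 : j ≠ 0 := by omega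
    simp only [hj0, if_false]
    split_ifs with h
    · have := mono 0 j (by omega) (by omega); linarith
    · have e1 := (hq i (by omega) hi).2.1
      have := mono (i + 1) j (by omega) (by omega); linarith
  · intro i hi
    simp only
    split_ifs with h
    · exact ⟨le_rfl, hb⟩
    · obtain ⟨e1, e2, -⟩ := hq i (by omega) hi
      have a1 := mono 0 i (by omega) (by omega)
      have a2 := mono (i + 1) (k + 1) (by omega) (by omega)
      constructor <;> linarith
  · intro i hi
    simp only
    split_ifs with h
    · exact h2
    · exact (hq i (by omega) hi).2.2


lemma cfz_cross {h h1 h2 : ℝ → ℝ} (d1 : ∀ x, HasDerivAt h (h1 x) x)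
    (d2 : ∀ x, HasDerivAt h1 (h2 x) x) (hz : ∀ x, h x = 0 → h1 x = 0 ∧ h2 x ≠ 0) {y x : ℝ}
    (hyx : y < x) (hy : h y < 0) (hx : 0 < h x) : False := by
  have hc : Continuous h := continuous_iff_continuousAt.2 fun x => (d1 x).continuousAt
  have e1 : deriv h = h1 := funext fun x => (d1 x).deriv
  have e2 : deriv h1 = h2 := funext fun x => (d2 x).deriv
  set T : Set ℝ := {t | t ≤ x ∧ h t < 0} with hT
  have hTb : BddAbove T := ⟨x, fun t ht => ht.1⟩
  have hTn : T.Nonempty := ⟨y, hyx.le, hy⟩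
  set s := sSup T with hs
  have hlub : IsLUB T s := isLUB_csSup hTn hTb
  have hsx : s ≤ x := hlub.2 fun t ht => ht.1
  have hcl : s ∈ closure T := csSup_mem_closure hTn hTb
  have hle : h s ≤ 0 := closure_minimal (fun t (ht : t ∈ T) => ht.2.le) (isClosed_le hc continuous_const) hcl
  have hsx' : s < x := lt_of_le_of_ne hsx (by rintro h; rw [h] at hle; linarith)
  have hright : ∀ t, s < t → t ≤ x → 0 ≤ h t := by
    intro t h1 h2
    by_contra hcon
    push Not at hcon
    exact absurd (hlub.1 (show t ∈ T from ⟨h2, hcon⟩)) (by linarith)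
  have hge : 0 ≤ h s := by
    have : Tendsto h (𝓝[>] s) (𝓝 (h s)) := hc.continuousAt.tendsto.mono_left nhdsWithin_le_nhds
    refine ge_of_tendsto this ?_
    filter_upwards [Ioo_mem_nhdsGT hsx'] with t ht using hright t ht.1 ht.2.le
  have hs0 : h s = 0 := le_antisymm hle hge
  obtain ⟨hs1, hs2⟩ := hz s hs0
  rcases lt_or_gt_of_ne hs2 with hneg | hpos
  · have hmax : IsLocalMax h s := isLocalMax_of_deriv_deriv_neg (by rw [e1, e2]; exact hneg)
      (by rw [e1]; exact hs1) hc.continuousAt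
    obtain ⟨δ, hδ, hball⟩ := Metric.eventually_nhds_iff.1 hmax
    set u := min (s + δ) x with hu
    have hsu : s < u := lt_min (by linarith) hsx'
    have hzero : ∀ t ∈ Set.Ioo s u, h t = 0 := by
      intro t ht
      have a1 := hright t ht.1 (ht.2.le.trans (min_le_right _ _))
      have a2 := hball (y := t) (by
        rw [Real.dist_eq, abs_lt]
        have := ht.2.trans_le (min_le_left _ _)
        constructor <;> linarith [ht.1])
      linarith
    have hzero1 : ∀ t ∈ Set.Ioo s u, h1 t = 0 := fun t ht => (hz t (hzero t ht)).1
    obtain ⟨t, ht⟩ : ∃ t, t ∈ Set.Ioo s u := Set.nonempty_Ioo.2 hsu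
    apply (hz t (hzero t ht)).2
    have : h1 =ᶠ[𝓝 t] fun _ => 0 := by
      filter_upwards [isOpen_Ioo.mem_nhds ht] with v hv using hzero1 v hv
    rw [← e2, this.deriv_eq]; simp
  · have hmin : IsLocalMin h s := isLocalMin_of_deriv_deriv_pos (by rw [e1, e2]; exact hpos)
      (by rw [e1]; exact hs1) hc.continuousAt
    obtain ⟨t, ht, htT⟩ := mem_closure_iff_nhds.1 hcl _ hmin
    have a1 : h s ≤ h t := ht
    linarith [htT.2]

lemma cfz_fact (k : ℕ) (hk : 3 ≤ k) : (k.factorial : ℝ) < 2 * ((k : ℝ) / 2) ^ k := by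
  induction k, hk using Nat.le_induction with
  | base => norm_num [Nat.factorial]
  | succ k hk ih =>
    have hk0 : (0 : ℝ) < k := by exact_mod_cast (by omega : 0 < k)
    have hb : 2 * (k : ℝ) ^ k ≤ (k + 1) ^ k := by
      have hpos : 0 < 1 / (k : ℝ) := by positivity
      have := one_add_mul_le_pow (a := 1 / (k : ℝ)) (by linarith) k
      have e : (k : ℝ) * (1 / k) = 1 := by field_simp
      rw [e] at this
      calc 2 * (k : ℝ) ^ k ≤ (1 + 1 / (k:ℝ)) ^ k * (k:ℝ) ^ k := by
            gcongr; linarith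
        _ = (k + 1) ^ k := by rw [← mul_pow]; congr 1; field_simp
    rw [Nat.factorial_succ]; push_cast
    calc ((k:ℝ) + 1) * (k.factorial : ℝ) < (k + 1) * (2 * ((k : ℝ) / 2) ^ k) := by gcongr
      _ = (k + 1) * (2 * (k : ℝ) ^ k) / 2 ^ k := by rw [div_pow]; ring
      _ ≤ (k + 1) * (k + 1) ^ k / 2 ^ k := by gcongr
      _ = 2 * (((k : ℝ) + 1) / 2) ^ (k + 1) := by rw [div_pow]; field_simp; ring

lemma cfzS_avg (m : ℕ) (hm : 1 ≤ m) :
    ∑ l ∈ Finset.range m, cfzS (2 * m) (2 * m) ((Real.pi * l / m : ℝ) : ℂ) =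
      ((m * (2 * (((2 * m : ℕ) : ℝ) / 2) ^ (2 * m)) : ℝ) : ℂ) := by
  have hm0 : (m : ℂ) ≠ 0 := by exact_mod_cast (by omega : m ≠ 0)
  set ω := Complex.exp (2 * Real.pi * Complex.I / m) with hω
  have hprim : IsPrimitiveRoot ω m := Complex.isPrimitiveRoot_exp m (by omega)
  unfold cfzS
  rw [Finset.sum_comm]
  have inner : ∀ j ∈ Finset.range (2 * m + 1), ∑ l ∈ Finset.range m,
      cfzC (2 * m) j * (Complex.I * (2 * j - (2 * m : ℕ))) ^ (2 * m) *
        Complex.exp (Complex.I * (2 * j - (2 * m : ℕ)) * ((Real.pi * l / m : ℝ) : ℂ)) =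
      cfzC (2 * m) j * (Complex.I * (2 * j - (2 * m : ℕ))) ^ (2 * m) *
        ∑ l ∈ Finset.range m, (ω ^ j) ^ l := by
    intro j _
    rw [Finset.mul_sum]
    refine Finset.sum_congr rfl fun l _ => ?_
    congr 1
    rw [hω, ← Complex.exp_nat_mul, ← Complex.exp_nat_mul]
    rw [← mul_one (Complex.exp (Complex.I * _ * _)), ← Complex.exp_nat_mul_two_pi_mul_I l, ← Complex.exp_add]
    congr 1
    push_cast
    field_simp
    ring
  rw [Finset.sum_congr rfl inner]
  have key : ∀ j ∈ Finset.range (2 * m + 1), cfzC (2 * m) j *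
      (Complex.I * (2 * j - (2 * m : ℕ))) ^ (2 * m) * ∑ l ∈ Finset.range m, (ω ^ j) ^ l =
      (if j = 0 then (m : ℂ) ^ (2 * m) * m else 0) + if j = 2 * m then (m : ℂ) ^ (2 * m) * m else 0 := by
    intro j hj
    have hj' : j < 2 * m + 1 := Finset.mem_range.1 hj
    have hI : (1 / (2 * Complex.I)) ^ (2 * m) * (Complex.I * (2 * m)) ^ (2 * m) = (m : ℂ) ^ (2 * m) := by
      rw [← mul_pow]
      congr 1
      field_simp
    by_cases h0 : j = 0
    · subst h0
      have : (0:ℕ) ≠ 2 * m := by omega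
      simp only [this, if_false, if_true, cfzC]
      simp
      rw [← hI]; simp
    by_cases h2 : j = 2 * m
    · subst h2
      simp only [h0, if_false, if_true, cfzC]
      have : ω ^ (2 * m) = 1 := by rw [mul_comm, pow_mul, hprim.pow_eq_one, one_pow]
      rw [this, ← hI]
      simp
      left; congr 1; ring
    simp only [h0, h2, if_false, add_zero]
    by_cases h1 : j = m
    · subst h1
      have : 2 * j ≠ 0 := by omega
      simp [this]
    · have hne : ω ^ j ≠ 1 := by
        rw [Ne, hprim.pow_eq_one_iff_dvd]
        rintro ⟨c, rfl⟩
        have c1 : c ≠ 0 := by rintro rfl; simp at h0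
        have c2 : c ≠ 1 := by rintro rfl; simp at h1
        have c3 : c ≠ 2 := by rintro rfl; exact h2 (mul_comm _ _)
        have : m * 3 ≤ m * c := Nat.mul_le_mul_left _ (by omega)
        omega
      have hg : (ω ^ j - 1) * ∑ l ∈ Finset.range m, (ω ^ j) ^ l = 0 := by
        rw [mul_geom_sum, ← pow_mul, mul_comm j, pow_mul, hprim.pow_eq_one, one_pow, sub_self]
      rw [(mul_eq_zero.1 hg).resolve_left (sub_ne_zero.2 hne), mul_zero]
  rw [Finset.sum_congr rfl key, Finset.sum_add_distrib, Finset.sum_ite_eq', Finset.sum_ite_eq']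
  simp
  ring

lemma cfzS_at0 (k : ℕ) : (∀ n < k, cfzS k n 0 = 0) ∧ cfzS k k 0 = k.factorial := by
  set D : ℂ → ℂ := dslope Complex.sin 0 with hD
  have hDd : Differentiable ℂ D := by
    rw [← differentiableOn_univ]
    exact (Complex.differentiableOn_dslope univ_mem).2 Complex.differentiable_sin.differentiableOn
  have hs : ∀ z, Complex.sin z = z * D z := by
    intro z
    have := sub_smul_dslope Complex.sin 0 z
    simpa using this.symm
  have hD0 : D 0 = 1 := by simp [hD]
  have main : ∀ n t, n + t = k → ∃ R : ℂ → ℂ, ∀ z, cfzS k n z =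
      (z - 0) ^ t * (((n + t).factorial : ℂ) / (t.factorial : ℂ) * (D z) ^ k + (z - 0) * R z) := by
    intro n t hnt
    obtain ⟨R, -, hR⟩ := iteratedDeriv_mul_pow_sub_of_analytic (k := n) (t := t) (z₀ := (0:ℂ))
      (R := fun z => Complex.sin z ^ k) (R₁ := fun z => D z ^ k)
      (fun z => (hDd.pow k).analyticAt z) (fun z => by rw [hnt, hs, mul_pow]; simp)
    exact ⟨R, fun z => by rw [← cfzS_iter]; exact hR z⟩
  constructor
  · intro n hn
    obtain ⟨R, hR⟩ := main n (k - n) (by omega)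
    rw [hR]
    have : k - n ≠ 0 := by omega
    simp [this]
  · obtain ⟨R, hR⟩ := main k 0 (by omega)
    rw [hR]
    simp [hD0]

lemma cfzS_period (k n : ℕ) (x : ℂ) : cfzS k n (x + Real.pi) = (-1) ^ k * cfzS k n x := by
  unfold cfzS
  rw [Finset.mul_sum]
  refine Finset.sum_congr rfl fun j _ => ?_
  have : Complex.exp (Complex.I * (2 * j - k) * (x + Real.pi)) =
      (-1) ^ k * Complex.exp (Complex.I * (2 * j - k) * x) := by
    have e : ((-1 : ℂ)) ^ k = Complex.exp (-(k * (Real.pi * Complex.I))) := by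
      rw [Complex.exp_neg, Complex.exp_nat_mul, Complex.exp_pi_mul_I, ← inv_pow]; norm_num
    rw [e, ← Complex.exp_add, ← mul_one (Complex.exp (-_ + _)), ← Complex.exp_nat_mul_two_pi_mul_I j,
      ← Complex.exp_add]
    congr 1; ring
  rw [this]; ring

lemma cfz_trig (k : ℕ) (hk1 : 1 ≤ k) (hk2 : k ≠ 2)
    (h1 : ∀ x : ℂ, Complex.sin x = 0 → cfzS k k x = k.factorial)
    (h2 : ∀ x : ℂ, cfzS k k x = k.factorial → cfzS k (k + 1) x = 0) : False := by
  obtain ⟨z0, z1⟩ := cfzS_at0 k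
  have hfac : (k.factorial : ℂ) ≠ 0 := by exact_mod_cast k.factorial_ne_zero
  have hper := fun n => cfzS_period k n 0
  simp only [zero_add] at hper
  have heven : Even k := by
    by_contra hodd
    rw [Nat.not_even_iff_odd] at hodd
    have e1 := h1 Real.pi Complex.sin_pi
    rw [hper, hodd.neg_one_pow, z1] at e1
    apply hfac
    linear_combination (-1/2) * e1
  obtain ⟨m, hm⟩ := heven
  have hm' : k = 2 * m := by omega
  have hpk : ((-1 : ℂ)) ^ k = 1 := by rw [hm', pow_mul]; norm_num
  have G0 : ∀ n < k, cfzG k n 0 = 0 := fun n hn => by simp [cfzG, z0 n hn]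
  have Gp : ∀ n < k, cfzG k n Real.pi = 0 := fun n hn => by simp [cfzG, hper, z0 n hn]
  have Gz : cfzG k (k + 1) 0 = 0 := by simp [cfzG, h2 0 z1]
  obtain ⟨r, hr1, hr2, hr3⟩ := cfz_count' (cfzG_deriv k) k Real.pi_pos G0 Gp Gz
  have hinj : ∀ i < k, ∀ j < k, i ≠ j →
      Complex.exp (2 * Complex.I * r i) ≠ Complex.exp (2 * Complex.I * r j) := by
    have aux : ∀ i < k, ∀ j < k, i < j →
      Complex.exp (2 * Complex.I * r i) ≠ Complex.exp (2 * Complex.I * r j) := by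
      intro i hi j hj hij he
      rw [Complex.exp_eq_exp_iff_exists_int] at he
      obtain ⟨N, hN⟩ := he
      have hN' : (r i : ℂ) = r j + N * Real.pi := by
        have : (2 * Complex.I) ≠ 0 := by simp
        apply mul_left_cancel₀ this
        rw [hN]; ring
      have hN2 : r i = r j + N * Real.pi := by exact_mod_cast hN'
      have b1 := hr1 i hi j hj hij
      have b2 := (hr2 i hi).1
      have b3 := (hr2 j hj).2
      have c1 : (N : ℝ) < 0 := by
        by_contra hc; push Not at hc
        have := mul_nonneg hc Real.pi_pos.le
        linarith
      have c2 : (-1 : ℝ) < N := by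
        by_contra hc; push Not at hc
        have := mul_le_mul_of_nonneg_right hc Real.pi_pos.le
        linarith
      have c1' : N < 0 := by exact_mod_cast c1
      have c2' : -1 < N := by exact_mod_cast c2
      omega
    intro i hi j hj hij
    rcases Nat.lt_or_gt_of_ne hij with h | h
    · exact aux i hi j hj h
    · exact (aux j hj i hi h).symm
  have hsimple : ∀ x : ℝ, cfzG k (k + 1) x = 0 → cfzG k (k + 2) x ≠ 0 := by
    intro x hx hx2
    refine cfzS_simple k (k + 1) hk1 r hinj (fun i hi => ?_) x ?_ ?_
    · rw [← cfzG_coe, hr3 i hi]; simp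
    · rw [← cfzG_coe, hx]; simp
    · rw [← cfzG_coe, hx2]; simp
  -- a point where the `k`-th derivative is large
  obtain ⟨x, hx0, hx⟩ : ∃ x : ℝ, 0 ≤ x ∧ (k.factorial : ℝ) < cfzG k k x := by
    by_contra hcon
    push Not at hcon
    have havg := cfzS_avg m (by omega)
    rw [← hm'] at havg
    have h3 : ∑ l ∈ Finset.range m, cfzG k k (Real.pi * l / m) = m * (2 * ((k : ℝ) / 2) ^ k) := by
      have : ((∑ l ∈ Finset.range m, cfzG k k (Real.pi * l / m) : ℝ) : ℂ) =
          ((m * (2 * ((k : ℝ) / 2) ^ k) : ℝ) : ℂ) := by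
        rw [Complex.ofReal_sum, Finset.sum_congr rfl fun l _ => cfzG_coe k k _]
        exact havg
      exact_mod_cast this
    have h4 : ∑ l ∈ Finset.range m, cfzG k k (Real.pi * l / m) ≤ ∑ l ∈ Finset.range m, (k.factorial : ℝ) :=
      Finset.sum_le_sum fun l _ => hcon _ (by positivity)
    rw [h3, Finset.sum_const, Finset.card_range, nsmul_eq_mul] at h4
    have hmp : (0 : ℝ) < m := by exact_mod_cast (by omega : 0 < m)
    have := le_of_mul_le_mul_left h4 hmp
    have := cfz_fact k (by omega)
    linarith
  -- a point to the left where it vanishes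
  obtain ⟨y, hy0, hy⟩ : ∃ y : ℝ, y < 0 ∧ cfzG k k y = 0 := by
    obtain ⟨p, hp, hp0, hpn, hpz⟩ := cfz_count (cfzG_deriv k) k Real.pi_pos G0 Gp k le_rfl
    refine ⟨p k - Real.pi, ?_, ?_⟩
    · have := hp k le_rfl
      rw [hpn] at this; linarith
    · have e := cfzS_period k k ((p k - Real.pi : ℝ) : ℂ)
      rw [hpk, one_mul, ← Complex.ofReal_add, sub_add_cancel, ← cfzG_coe, ← cfzG_coe,
        hpz k hk1 le_rfl] at e
      exact_mod_cast e.symm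
  refine cfz_cross (h := fun x => cfzG k k x - k.factorial) (h1 := cfzG k (k + 1))
    (h2 := cfzG k (k + 2)) (fun x => (cfzG_deriv k k x).sub_const _) (cfzG_deriv k (k + 1)) ?_
    (hy0.trans_le hx0) ?_ ?_
  · intro t ht
    have ht' : cfzG k k t = k.factorial := by simpa [sub_eq_zero] using ht
    have e1 : cfzS k k t = k.factorial := by rw [← cfzG_coe, ht']; simp
    have e2 : cfzG k (k + 1) t = 0 := by simp [cfzG, h2 t e1]
    exact ⟨e2, hsimple t e2⟩
  · simp only [hy, zero_sub]
    have : (0:ℝ) < k.factorial := by exact_mod_cast k.factorial_pos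
    linarith
  · linarith


lemma cfz_exp_case {f : ℂ → ℂ} {D μ : ℂ} (hD : D ≠ 0) (hμ : μ ≠ 0) (hf : ∀ z, f z = D * Complex.exp (μ * z))
    {k : ℕ} {a : ℂ} (ha : a ≠ 0)
    (hE2 : ∀ z, iteratedDeriv k f z = a → iteratedDeriv (k + 1) f z = 0) : False := by
  have hit : ∀ n, iteratedDeriv n f = fun z => D * μ ^ n * Complex.exp (μ * z) := by
    intro n
    induction n with
    | zero => funext z; simp [hf]
    | succ n ih =>
      rw [iteratedDeriv_succ, ih]; funext z
      refine ((((hasDerivAt_id' z).const_mul μ).cexp).const_mul (D * μ ^ n)).deriv.trans ?_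
      ring
  have hne : D * μ ^ k ≠ 0 := mul_ne_zero hD (pow_ne_zero _ hμ)
  set z := Complex.log (a / (D * μ ^ k)) / μ with hz
  have e : Complex.exp (μ * z) = a / (D * μ ^ k) := by
    rw [hz, mul_div_cancel₀ _ hμ, Complex.exp_log (div_ne_zero ha hne)]
  have h1 : iteratedDeriv k f z = a := by
    rw [hit]; simp only; rw [e]; field_simp
  have h2 := hE2 z h1
  rw [hit] at h2
  simp [hD, hμ, Complex.exp_ne_zero] at h2

lemma cfz_sin_case {f : ℂ → ℂ} {E w z1 : ℂ} (hE : E ≠ 0) (hw : w ≠ 0) {k : ℕ}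
    (hf : ∀ z, f z = E * Complex.sin (w * (z - z1)) ^ k) (hk1 : 1 ≤ k) (hk2 : k ≠ 2)
    {a : ℂ} (hE1 : ∀ z, f z = 0 → iteratedDeriv k f z = a)
    (hE2 : ∀ z, iteratedDeriv k f z = a → iteratedDeriv (k + 1) f z = 0) : False := by
  have hit : ∀ n, iteratedDeriv n f = fun z => E * w ^ n * cfzS k n (w * (z - z1)) := by
    intro n
    induction n with
    | zero => funext z; simp [hf, cfzS_zero]
    | succ n ih =>
      rw [iteratedDeriv_succ, ih]; funext z
      have h0 : HasDerivAt (fun z => w * (z - z1)) (w * 1) z := ((hasDerivAt_id' z).sub_const z1).const_mul w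
      have h1 : HasDerivAt (fun z => cfzS k n (w * (z - z1))) (cfzS k (n + 1) (w * (z - z1)) * (w * 1)) z :=
        HasDerivAt.comp (h₂ := cfzS k n) z (cfzS_deriv k n (w * (z - z1))) h0
      refine (h1.const_mul (E * w ^ n)).deriv.trans ?_
      ring
  have hx : ∀ x : ℂ, w * (x / w + z1 - z1) = x := fun x => by field_simp; ring
  have hEw : ∀ n : ℕ, E * w ^ n ≠ 0 := fun n => mul_ne_zero hE (pow_ne_zero _ hw)
  have hk0 : k ≠ 0 := by omega
  have e1 : ∀ x : ℂ, Complex.sin x = 0 → E * w ^ k * cfzS k k x = a := by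
    intro x hx0
    have := hE1 (x / w + z1) (by rw [hf, hx, hx0]; simp [hk0])
    rw [hit] at this
    simpa only [hx] using this
  have e0 := e1 0 Complex.sin_zero
  rw [(cfzS_at0 k).2] at e0
  refine cfz_trig k hk1 hk2 (fun x hx0 => mul_left_cancel₀ (hEw k) ((e1 x hx0).trans e0.symm)) ?_
  intro x hx0
  have := hE2 (x / w + z1) (by rw [hit]; simp only [hx]; rw [hx0, e0])
  rw [hit] at this
  simp only [hx] at this
  exact (mul_eq_zero.1 this).resolve_left (hEw _)

lemma cfz_main0 (f : ℂ → ℂ) (k : ℕ) (hk1 : 1 ≤ k) (hk2 : k ≠ 2)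
    (hf : Differentiable ℂ f) (hnc : ¬ ∃ c : ℂ, ∀ z, f z = c) {K : ℝ}
    (hgr : ∀ R : ℝ, 1 ≤ R → ∀ z : ℂ, ‖z‖ ≤ R → ‖f z‖ ≤ Real.exp (K * R ^ (11/10 : ℝ)))
    (hmult : ∀ z, f z = 0 → ∀ j < k, iteratedDeriv j f z = 0)
    (a : ℂ) (ha : a ≠ 0)
    (hE1 : ∀ z, f z = 0 → iteratedDeriv k f z = a)
    (hE2 : ∀ z, iteratedDeriv k f z = a → iteratedDeriv (k + 1) f z = 0) (h0 : f 0 ≠ 0) :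
    ∃ b : ℂ, ∀ z, f z = a * (z - b) ^ k / (Nat.factorial k : ℂ) := by
  have hfac : (k.factorial : ℂ) ≠ 0 := by exact_mod_cast k.factorial_ne_zero
  have hk0 : k ≠ 0 := by omega
  have hloc : ∀ b, f b = 0 → ∃ φ : ℂ → ℂ, AnalyticAt ℂ φ b ∧
      ∀ᶠ z in 𝓝 b, f z = (z - b) ^ k * (a / (k.factorial : ℂ) + (z - b) ^ 2 * φ z) :=
    fun b hb => cfz_local hf (hmult b hb) (hE1 b hb) (hE2 b (hE1 b hb))
  obtain ⟨c, hc⟩ := cfz_riccati0 hf hk1 (div_ne_zero ha hfac) h0 hloc hgr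
  obtain ⟨l, A, B, ⟨hl, hs⟩ | hs⟩ := cfz_solve hf hk1 h0 hc
  · exfalso
    have hlk : (k : ℂ) * l ≠ 0 := mul_ne_zero (by exact_mod_cast hk0) hl
    by_cases hA : A = 0
    · have hB : B ≠ 0 := by
        rintro rfl
        exact h0 (by rw [hs, hA]; simp [hk0])
      refine cfz_exp_case (f := f) (D := B ^ k) (μ := -(k * l)) (pow_ne_zero _ hB) (neg_ne_zero.2 hlk) (fun z => ?_) ha hE2
      rw [hs, hA, zero_mul, zero_add, mul_pow, ← Complex.exp_nat_mul]
      congr 2; ring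
    by_cases hB : B = 0
    · refine cfz_exp_case (f := f) (D := A ^ k) (μ := k * l) (pow_ne_zero _ hA) hlk (fun z => ?_) ha hE2
      rw [hs, hB, zero_mul, add_zero, mul_pow, ← Complex.exp_nat_mul]
      congr 2; ring
    set z1 := Complex.log (-B / A) / (2 * l) with hz1
    have hz : Complex.exp (l * z1) ^ 2 = -B / A := by
      rw [← Complex.exp_nat_mul]
      have : ((2 : ℕ) : ℂ) * (l * z1) = Complex.log (-B / A) := by
        rw [hz1]; push_cast; field_simp
      rw [this, Complex.exp_log (div_ne_zero (neg_ne_zero.2 hB) hA)]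
    have hB' : B = -A * Complex.exp (l * z1) ^ 2 := by rw [hz]; field_simp
    refine cfz_sin_case (f := f) (E := (A * Complex.exp (l * z1) * (2 * Complex.I)) ^ k)
      (w := -Complex.I * l) (z1 := z1) (k := k) ?_ ?_ (fun z => ?_) hk1 hk2 hE1 hE2
    · exact pow_ne_zero _ (by simp [hA, Complex.exp_ne_zero])
    · simp [hl]
    · rw [hs, ← mul_pow]
      congr 1
      rw [Complex.sin, hB']
      have r1 : -(-Complex.I * l * (z - z1)) * Complex.I = -(l * z) + l * z1 := by
        linear_combination (l * (z - z1)) * Complex.I_mul_I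
      have r2 : (-Complex.I * l * (z - z1)) * Complex.I = l * z - l * z1 := by
        linear_combination (-l * (z - z1)) * Complex.I_mul_I
      rw [r1, r2, Complex.exp_add, Complex.exp_sub]
      have := Complex.exp_ne_zero (l * z1)
      field_simp
      rw [Complex.I_sq]; ring
  · have hB : B ≠ 0 := by
      rintro rfl
      exact hnc ⟨A ^ k, fun z => by rw [hs]; simp⟩
    set b := -A / B with hb
    have hs' : ∀ z, f z = B ^ k * (z - b) ^ k := by
      intro z
      rw [hs, ← mul_pow]; congr 1
      rw [hb]; field_simp; ring
    have hfb : f b = 0 := by rw [hs']; simp [hk0]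
    obtain ⟨R, -, hR⟩ := iteratedDeriv_mul_pow_sub_of_analytic (k := k) (t := 0) (z₀ := b)
      (R := f) (R₁ := fun z => B ^ k) (fun z => analyticAt_const) (fun z => by rw [hs']; ring)
    have h1 := hE1 b hfb
    rw [hR] at h1
    simp at h1
    refine ⟨b, fun z => ?_⟩
    rw [hs', ← h1]; field_simp

/-- Chang–Fang–Zalcman: a nonconstant entire function of order at most 1, all of whose
zeros have multiplicity at least `k` (`k ≠ 2`), with `E_f(0) ⊆ E_{f^{(k)}}(a) ⊆ E_{f^{(k+1)}}(0)`,
is `a (z - b)^k / k!`. -/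
theorem stmt_0 (f : ℂ → ℂ) (k : ℕ) (hk1 : 1 ≤ k) (hk2 : k ≠ 2)
    (hf : Differentiable ℂ f) (hnc : ¬ ∃ c : ℂ, ∀ z, f z = c)
    (horder : ∀ ε : ℝ, 0 < ε → ∃ C : ℝ, ∀ z : ℂ, ‖f z‖ ≤ C * Real.exp (‖z‖ ^ (1 + ε)))
    (hmult : ∀ z, f z = 0 → ∀ j < k, iteratedDeriv j f z = 0)
    (a : ℂ) (ha : a ≠ 0)
    (hE1 : ∀ z, f z = 0 → iteratedDeriv k f z = a)
    (hE2 : ∀ z, iteratedDeriv k f z = a → iteratedDeriv (k + 1) f z = 0) :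
    ∃ b : ℂ, ∀ z, f z = a * (z - b) ^ k / (Nat.factorial k : ℂ) := by
  obtain ⟨z0, hz0⟩ : ∃ z0, f z0 ≠ 0 := by
    by_contra hcon
    push Not at hcon
    exact hnc ⟨0, hcon⟩
  obtain ⟨C, hC⟩ := horder (1 / 10) (by norm_num)
  rw [show (1 + 1 / 10 : ℝ) = 11 / 10 by norm_num] at hC
  have hit : ∀ n z, iteratedDeriv n (fun z => f (z + z0)) z = iteratedDeriv n f (z + z0) := by
    intro n z
    rw [iteratedDeriv_comp_add_const]
  obtain ⟨b, hb⟩ := cfz_main0 (fun z => f (z + z0)) k hk1 hk2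
    (hf.comp (differentiable_id.add_const z0))
    (fun ⟨c, hc⟩ => hnc ⟨c, fun z => by simpa using hc (z - z0)⟩)
    (K := |C| + (1 + ‖z0‖) ^ (11/10 : ℝ)) (fun R hR z hz => by
      have hR1 : 1 ≤ R ^ (11/10 : ℝ) := Real.one_le_rpow hR (by norm_num)
      have n1 : ‖z + z0‖ ≤ (1 + ‖z0‖) * R := by
        have := norm_add_le z z0
        nlinarith [norm_nonneg z0]
      have n2 : ‖z + z0‖ ^ (11/10 : ℝ) ≤ (1 + ‖z0‖) ^ (11/10 : ℝ) * R ^ (11/10 : ℝ) := by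
        rw [← Real.mul_rpow (by positivity) (by linarith)]
        exact Real.rpow_le_rpow (norm_nonneg _) n1 (by norm_num)
      have n3 : C ≤ Real.exp (|C| * R ^ (11/10 : ℝ)) := by
        have a1 := le_abs_self C
        have a2 := Real.add_one_le_exp (|C| * R ^ (11/10 : ℝ))
        nlinarith [abs_nonneg C]
      calc ‖f (z + z0)‖ ≤ C * Real.exp (‖z + z0‖ ^ (11/10 : ℝ)) := hC _
        _ ≤ Real.exp (|C| * R ^ (11/10 : ℝ)) *
            Real.exp ((1 + ‖z0‖) ^ (11/10 : ℝ) * R ^ (11/10 : ℝ)) := by gcongr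
        _ = Real.exp ((|C| + (1 + ‖z0‖) ^ (11/10 : ℝ)) * R ^ (11/10 : ℝ)) := by
            rw [← Real.exp_add]; congr 1; ring)
    (fun z hz j hj => by rw [hit]; exact hmult _ hz j hj) a ha
    (fun z hz => by rw [hit]; exact hE1 _ hz)
    (fun z hz => by rw [hit] at hz ⊢; exact hE2 _ hz) (by simpa using hz0)
  refine ⟨b + z0, fun z => ?_⟩
  have := hb (z - z0)
  simp only [sub_add_cancel] at this
  rw [this, show z - z0 - b = z - (b + z0) by ring]
end

section
/- Let f be a nonconstant entire function of order at most 1, all of whose zeros are multiple, let s ≥ 4 be an even integer and a ≠ 0 a complex constant. If every zero of f is a zero of f'' − a, and every zero of f'' − a is a common zero of f''' and f^{(s)}, then f(z) = a(z − b)^2 / 2 for some constant b ∈ ℂ. -/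
section Helpers

open Filter Topology Metric

lemma exists_div (F : ℂ → ℂ) (hF : Differentiable ℂ F) (b : ℂ) (hb : F b = 0) :
    ∃ G : ℂ → ℂ, Differentiable ℂ G ∧ ∀ z, F z = (z - b) * G z := by
  refine ⟨dslope F b, ?_, fun z => ?_⟩
  · rw [← differentiableOn_univ] at hF ⊢
    exact (Complex.differentiableOn_dslope univ_mem).2 hF
  · have := sub_smul_dslope F b z
    rw [smul_eq_mul, hb, sub_zero] at this
    exact this.symm

lemma exists_div_sq (F : ℂ → ℂ) (hF : Differentiable ℂ F) (b : ℂ) (hb : F b = 0)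
    (hb' : deriv F b = 0) :
    ∃ G : ℂ → ℂ, Differentiable ℂ G ∧ ∀ z, F z = (z - b) ^ 2 * G z := by
  obtain ⟨G, hG, h⟩ := exists_div F hF b hb
  have h1 : G b = 0 := by
    have : F = fun z => (z - b) * G z := funext h
    have h2 : HasDerivAt F (1 * G b + (b - b) * deriv G b) b := by
      rw [this]
      exact ((hasDerivAt_id b).sub_const b).mul (hG b).hasDerivAt
    rw [h2.deriv] at hb'
    simpa using hb'
  obtain ⟨H, hH, h'⟩ := exists_div G hG b h1
  exact ⟨H, hH, fun z => by rw [h, h']; ring⟩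

lemma second_deriv_of_div_sq (F G : ℂ → ℂ) (hG : Differentiable ℂ G) (b : ℂ)
    (h : ∀ z, F z = (z - b) ^ 2 * G z) : iteratedDeriv 2 F b = 2 * G b := by
  have hF : F = fun z => (z - b) ^ 2 * G z := funext h
  have hG' : Differentiable ℂ (deriv G) := hG.deriv
  have h1 : deriv F = fun z => (2 * (z - b)) * G z + (z - b) ^ 2 * deriv G z := by
    funext z
    rw [hF]
    have := (((hasDerivAt_id z).sub_const b).pow 2).mul (hG z).hasDerivAt
    exact this.deriv.trans (by simp)
  rw [iteratedDeriv_succ, iteratedDeriv_one, h1]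
  have := ((((hasDerivAt_id b).sub_const b).const_mul 2).mul (hG b).hasDerivAt).add
    ((((hasDerivAt_id b).sub_const b).pow 2).mul (hG' b).hasDerivAt)
  exact this.deriv.trans (by simp)

/-- Dividing out finitely many double zeros. -/
lemma exists_div_prod (S : Finset ℂ) : ∀ (F : ℂ → ℂ), Differentiable ℂ F →
    (∀ a ∈ S, a ≠ 0 ∧ F a = 0 ∧ deriv F a = 0) →
    ∃ G : ℂ → ℂ, Differentiable ℂ G ∧ ∀ z, F z = (∏ a ∈ S, (1 - z / a) ^ 2) * G z := by
  classical
  induction S using Finset.induction_on with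
  | empty => intro F hF _; exact ⟨F, hF, fun z => by simp⟩
  | insert b S hbS ih =>
    intro F hF hS
    obtain ⟨hb0, hb, hb'⟩ := hS b (by simp)
    obtain ⟨G, hG, h⟩ := exists_div_sq F hF b hb hb'
    obtain ⟨H, hH, h'⟩ := ih G hG (by
      intro a ha
      obtain ⟨ha0, h1, h2⟩ := hS a (by simp [ha])
      have hab : a - b ≠ 0 := sub_ne_zero.2 (fun e => hbS (e ▸ ha))
      have hGa : G a = 0 := by
        rw [h] at h1
        simpa [hab] using h1
      refine ⟨ha0, hGa, ?_⟩
      have hFe : F = fun z => (z - b) ^ 2 * G z := funext h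
      have := (((hasDerivAt_id a).sub_const b).pow 2).mul (hG a).hasDerivAt
      rw [hFe] at h2
      have h3 := h2.symm.trans this.deriv
      simpa [hGa, hab] using h3)
    refine ⟨fun z => b ^ 2 * H z, hH.const_mul _, fun z => ?_⟩
    rw [Finset.prod_insert hbS, h, h']
    field_simp
    ring

lemma sum_rpow_le (S : Finset ℂ) (y : ℂ → ℝ) (hy : ∀ a, 0 ≤ y a) (q : ℝ) (hq : 1 ≤ q) :
    ∑ a ∈ S, y a ^ q ≤ (∑ a ∈ S, y a) ^ q := by
  classical
  induction S using Finset.induction_on with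
  | empty => simp; positivity
  | insert b S hbS ih =>
    rw [Finset.sum_insert hbS, Finset.sum_insert hbS]
    have := Real.add_rpow_le_rpow_add (hy b) (Finset.sum_nonneg (fun a _ => hy a) : 0 ≤ ∑ a ∈ S, y a) hq
    linarith

open MeasureTheory in
lemma pick : ∃ C : ℝ, 0 < C ∧ ∀ (S : Finset ℂ) (c : ℂ → ℝ), ∃ t ∈ Set.Icc (1 : ℝ) 2,
    (∀ k ∈ S, t ≠ c k) ∧ ∑ k ∈ S, |t - c k| ^ (-(9 / 10) : ℝ) ≤ C * S.card := by
  set φ : ℝ → ℝ := (Set.Icc (-1 : ℝ) 1).indicator (fun x => |x| ^ (-(9 / 10) : ℝ)) with hφ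
  have hφ0 : ∀ x, 0 ≤ φ x := fun x => Set.indicator_nonneg (fun x _ => by positivity) x
  have hpos : IntervalIntegrable (fun x : ℝ => |x| ^ (-(9 / 10) : ℝ)) volume 0 1 := by
    refine (intervalIntegral.intervalIntegrable_rpow' (r := -(9/10)) (by norm_num)).congr ?_
    intro x hx
    rw [Set.uIoc_of_le zero_le_one] at hx
    simp only [abs_of_pos hx.1]
  have hneg : IntervalIntegrable (fun x : ℝ => |x| ^ (-(9 / 10) : ℝ)) volume (-1) 0 := by
    have := (IntervalIntegrable.iff_comp_neg (f := fun x : ℝ => |x| ^ (-(9 / 10) : ℝ)) (a := 0) (b := 1)).1 hpos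
    simpa using this.symm
  have hint : Integrable φ := by
    rw [hφ, integrable_indicator_iff measurableSet_Icc, integrableOn_Icc_iff_integrableOn_Ioc]
    exact (intervalIntegrable_iff_integrableOn_Ioc_of_le (by norm_num)).1 (hneg.trans hpos)
  set I := ∫ x, φ x with hI
  have hI0 : 0 ≤ I := integral_nonneg hφ0
  refine ⟨I + 1, by positivity, fun S c => ?_⟩
  set Ψ : ℝ → ℝ := fun t => ∑ k ∈ S, φ (t - c k) with hΨ
  have hΨi : Integrable Ψ := integrable_finsetSum _ (fun k _ => hint.comp_sub_right (c k))
  have hΨ0 : ∀ x, 0 ≤ Ψ x := fun x => Finset.sum_nonneg (fun k _ => hφ0 _)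
  have hN : (volume.restrict (Set.Icc (1 : ℝ) 2)) ((c '' S) ∪ (Set.Icc (1 : ℝ) 2)ᶜ) = 0 := by
    rw [measure_union_null_iff]
    refine ⟨?_, ?_⟩
    · exact (S.finite_toSet.image c).measure_zero _
    · simp
  have : IsProbabilityMeasure (volume.restrict (Set.Icc (1 : ℝ) 2)) := ⟨by simp; norm_num⟩
  obtain ⟨t, htN, ht⟩ := exists_notMem_null_le_integral hΨi.restrict hN
  have ht' : Ψ t ≤ S.card * I := by
    refine ht.trans ((setIntegral_le_integral hΨi (Eventually.of_forall hΨ0)).trans ?_)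
    rw [hΨ, integral_finsetSum _ (fun k _ => hint.comp_sub_right (c k))]
    simp [integral_sub_right_eq_self φ, hI]
  simp only [Set.mem_union, Set.mem_compl_iff, not_or, not_not] at htN
  refine ⟨t, htN.2, fun k hk e => htN.1 ⟨k, hk, e.symm⟩, ?_⟩
  calc ∑ k ∈ S, |t - c k| ^ (-(9 / 10) : ℝ) ≤ ∑ k ∈ S, (φ (t - c k) + 1) := by
        apply Finset.sum_le_sum
        intro k _
        by_cases h : t - c k ∈ Set.Icc (-1 : ℝ) 1
        · rw [hφ, Set.indicator_of_mem h]; linarith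
        · have h1 : 1 ≤ |t - c k| := by
            by_contra hlt
            exact h (abs_le.1 (not_le.1 hlt).le)
          have := Real.rpow_le_one_of_one_le_of_nonpos h1 (by norm_num : (-(9 / 10) : ℝ) ≤ 0)
          linarith [hφ0 (t - c k)]
    _ = Ψ t + S.card := by rw [Finset.sum_add_distrib]; simp [hΨ]
    _ ≤ _ := by linarith

lemma logder (G : ℂ → ℂ) (hG : Differentiable ℂ G) (R A : ℝ) (hR : 0 < R) (hA : 0 < A)
    (hne : ∀ z ∈ ball (0 : ℂ) (4 * R), G z ≠ 0)
    (hb : ∀ z ∈ ball (0 : ℂ) (4 * R), ‖G z‖ ≤ ‖G 0‖ * Real.exp A) :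
    ∀ z : ℂ, ‖z‖ ≤ 2 * R → ‖logDeriv G z‖ ≤ 12 * A / R ∧
      ‖deriv (logDeriv G) z‖ ≤ 24 * A / R ^ 2 := by
  have hdL : DifferentiableOn ℂ (logDeriv G) (ball 0 (4 * R)) := by
    intro z hz
    exact ((hG.deriv z).div (hG z) (hne z hz)).differentiableWithinAt
  obtain ⟨q, hq0, hq⟩ := (hdL.isExactOn_ball).with_val_at 0 0
  have h0 : (0 : ℂ) ∈ ball (0 : ℂ) (4 * R) := by simp [hR]
  have hG0 := hne 0 h0
  have hexp : ∀ z ∈ ball (0 : ℂ) (4 * R), G z = G 0 * Complex.exp (q z) := by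
    have key : ∀ z ∈ ball (0 : ℂ) (4 * R), G z * Complex.exp (-q z) = G 0 * Complex.exp (-q 0) := by
      intro z hz
      refine (isOpen_ball).is_const_of_deriv_eq_zero (𝕜 := ℂ) (f := fun z => G z * Complex.exp (-q z))
        (convex_ball _ _).isPreconnected ?_ ?_ hz h0
      · intro w hw
        exact ((hG w).mul ((hq w hw).differentiableAt.neg.cexp)).differentiableWithinAt
      · intro w hw
        have := (hG w).hasDerivAt.mul ((hq w hw).neg.cexp)
        refine this.deriv.trans ?_
        have h1 := hne w hw
        simp only [logDeriv_apply, Pi.zero_apply]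
        field_simp
        ring
    intro z hz
    have := key z hz
    rw [hq0, neg_zero, Complex.exp_zero, mul_one] at this
    rw [← this, mul_assoc, ← Complex.exp_add]; simp
  have hre : Set.MapsTo q (ball 0 (4 * R)) {z | z.re ≤ A} := by
    intro z hz
    have h1 := hb z hz
    rw [hexp z hz, norm_mul, Complex.norm_exp] at h1
    have h2 : Real.exp (q z).re ≤ Real.exp A := le_of_mul_le_mul_left h1 (norm_pos_iff.2 hG0)
    exact Real.exp_le_exp.1 h2
  have hqd : DifferentiableOn ℂ q (ball 0 (4 * R)) := fun z hz =>
    (hq z hz).differentiableAt.differentiableWithinAt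
  have hqb : ∀ z : ℂ, ‖z‖ ≤ 3 * R → ‖q z‖ ≤ 6 * A := by
    intro z hz
    have hz4 : z ∈ ball (0 : ℂ) (4 * R) := by simp; linarith
    refine (Complex.borelCaratheodory_zero hA hqd hre (by positivity) hz4 hq0).trans ?_
    rw [div_le_iff₀ (by linarith)]
    nlinarith
  have hsub : ∀ (z w : ℂ), w ∈ closedBall z (R / 2) → ‖w‖ ≤ ‖z‖ + R / 2 := by
    intro z w hw
    have h1 : ‖w - z‖ ≤ R / 2 := by simpa [dist_eq_norm] using hw
    have h2 : ‖w‖ ≤ ‖z‖ + ‖w - z‖ := by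
      have := norm_add_le z (w - z); simpa using this
    linarith
  have hLb : ∀ z : ℂ, ‖z‖ ≤ 5 / 2 * R → ‖logDeriv G z‖ ≤ 12 * A / R := by
    intro z hz
    have hz4 : z ∈ ball (0 : ℂ) (4 * R) := by simp; linarith
    rw [← (hq z hz4).deriv]
    have := Complex.norm_deriv_le_of_forall_mem_sphere_norm_le (f := q) (c := z) (R := R / 2) (C := 6 * A)
      (by positivity) ?_ ?_
    · refine this.trans (le_of_eq ?_); field_simp; norm_num
    · refine (hqd.mono ?_).diffContOnCl_ball (U := closedBall z (R/2)) subset_rfl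
      intro w hw
      have := hsub z w hw
      simp; linarith
    · intro w hw
      have := hsub z w (sphere_subset_closedBall hw)
      exact hqb w (by linarith)
  intro z hz
  refine ⟨hLb z (by linarith), ?_⟩
  have := Complex.norm_deriv_le_of_forall_mem_sphere_norm_le (f := logDeriv G) (c := z) (R := R / 2) (C := 12 * A / R)
      (by positivity) ?_ ?_
  · refine this.trans (le_of_eq ?_); field_simp; norm_num
  · refine (hdL.mono ?_).diffContOnCl_ball (U := closedBall z (R/2)) subset_rfl
    intro w hw
    have := hsub z w hw
    simp; linarith
  · intro w hw
    have := hsub z w (sphere_subset_closedBall hw)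
    exact hLb w (by linarith)

lemma zeros_finite (f : ℂ → ℂ) (hf : Differentiable ℂ f) (hf0 : f 0 ≠ 0) (R : ℝ) :
    {z | z ∈ closedBall (0 : ℂ) R ∧ f z = 0}.Finite := by
  by_contra hinf
  obtain ⟨x, _, hx⟩ := Set.Infinite.exists_accPt_of_subset_isCompact hinf
    (isCompact_closedBall (0 : ℂ) R) (fun z hz => hz.1)
  have han : AnalyticOnNhd ℂ f Set.univ := fun z _ => hf.analyticAt z
  have hfr : ∃ᶠ z in 𝓝[≠] x, f z = 0 :=
    (accPt_iff_frequently_nhdsNE.1 hx).mono (fun z hz => hz.2)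
  have := han.eqOn_zero_of_preconnected_of_frequently_eq_zero isPreconnected_univ (Set.mem_univ x) hfr
  exact hf0 (this (Set.mem_univ 0))

lemma norm_le_of_sphere (G : ℂ → ℂ) (hG : Differentiable ℂ G) (r M : ℝ) (hr : 0 < r)
    (h : ∀ z, ‖z‖ = r → ‖G z‖ ≤ M) (z : ℂ) (hz : ‖z‖ ≤ r) : ‖G z‖ ≤ M := by
  refine Complex.norm_le_of_forall_mem_frontier_norm_le (U := ball (0 : ℂ) r) isBounded_ball
    hG.diffContOnCl ?_ ?_
  · intro w hw
    rw [frontier_ball _ hr.ne'] at hw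
    exact h w (by simpa using hw)
  · rw [closure_ball _ hr.ne']; simpa using hz

set_option maxHeartbeats 2000000 in
lemma growth (f : ℂ → ℂ) (hf : Differentiable ℂ f) (hf0 : f 0 ≠ 0)
    (hm : ∀ z, f z = 0 → deriv f z = 0) (h2 : ∀ z, f z = 0 → iteratedDeriv 2 f z ≠ 0)
    (K : ℝ) (hK : ∀ R : ℝ, 1 ≤ R → ∀ z : ℂ, ‖z‖ ≤ R → ‖f z‖ ≤ Real.exp (K * R ^ (9 / 8 : ℝ))) :
    ∃ C : ℝ, ∀ R : ℝ, 1 ≤ R → ∃ r ∈ Set.Icc R (2 * R), ∀ z : ℂ, ‖z‖ = r →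
      f z ≠ 0 ∧ ‖deriv (logDeriv f) z / 2 + (logDeriv f z) ^ 2 / 4‖ ≤ C * R ^ (1 / 2 : ℝ) := by
  classical
  obtain ⟨C₀, hC₀, hpick⟩ := pick
  set B : ℝ := |K| * 12 ^ (9 / 8 : ℝ) + |Real.log ‖f 0‖| + 1 with hB
  have hBpos : 0 < B := by positivity
  set D : ℝ := (C₀ * B) ^ (10 / 9 : ℝ) with hD
  have hDpos : 0 < D := by positivity
  refine ⟨D ^ 2 + 12 * B + (2 * D + 12 * B) ^ 2 / 4, fun R hR => ?_⟩
  have hRpos : 0 < R := by linarith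
  set A : ℝ := B * R ^ (9 / 8 : ℝ) with hA
  have hR98 : 1 ≤ R ^ (9 / 8 : ℝ) := Real.one_le_rpow hR (by norm_num)
  have hApos : 0 < A := by positivity
  have hFb : ∀ z : ℂ, ‖z‖ ≤ 12 * R → ‖f z‖ ≤ ‖f 0‖ * Real.exp A := by
    intro z hz
    refine (hK (12 * R) (by linarith) z hz).trans ?_
    have hp : 0 < ‖f 0‖ := norm_pos_iff.2 hf0
    nth_rewrite 1 [← Real.exp_log hp]
    rw [← Real.exp_add]
    apply Real.exp_le_exp.2
    rw [Real.mul_rpow (by norm_num) hRpos.le, hA, hB]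
    have h1 : K * 12 ^ (9 / 8 : ℝ) ≤ |K| * 12 ^ (9 / 8 : ℝ) := by
      gcongr; exact le_abs_self K
    have h3 := neg_abs_le (Real.log ‖f 0‖)
    have h4 := abs_nonneg (Real.log ‖f 0‖)
    generalize R ^ (9 / 8 : ℝ) = y at *
    generalize (12 : ℝ) ^ (9 / 8 : ℝ) = v at *
    nlinarith [mul_le_mul_of_nonneg_right h1 (by linarith : 0 ≤ y)]
  have hfin := zeros_finite f hf hf0 (4 * R)
  set S := hfin.toFinset with hS
  have hSmem : ∀ a, a ∈ S ↔ ‖a‖ ≤ 4 * R ∧ f a = 0 := by intro a; simp [hS]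
  have hS0 : ∀ a ∈ S, a ≠ 0 := by
    intro a ha e; rw [e] at ha; exact hf0 ((hSmem 0).1 ha).2
  obtain ⟨G, hG, hfG⟩ := exists_div_prod S f hf (fun a ha =>
    ⟨hS0 a ha, ((hSmem a).1 ha).2, hm a ((hSmem a).1 ha).2⟩)
  have hG0 : G 0 = f 0 := by rw [hfG 0]; simp
  have hGne : ∀ z ∈ ball (0 : ℂ) (4 * R), G z ≠ 0 := by
    intro z hz hGz
    have hz' : ‖z‖ < 4 * R := by simpa using hz
    have hfz : f z = 0 := by rw [hfG, hGz, mul_zero]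
    have hzS : z ∈ S := (hSmem z).2 ⟨hz'.le, hfz⟩
    have hz0 := hS0 z hzS
    apply h2 z hfz
    rw [second_deriv_of_div_sq f (fun w => (1 / z ^ 2) * ((∏ a ∈ S.erase z, (1 - w / a) ^ 2) * G w))
      (by fun_prop) z ?_]
    · simp [hGz]
    · intro w
      rw [hfG w, ← Finset.mul_prod_erase S _ hzS]
      field_simp
      ring
  have hGs : ∀ z : ℂ, ‖z‖ = 12 * R → ‖G z‖ ≤ ‖f 0‖ * Real.exp A / 4 ^ S.card := by
    intro z hz
    rw [le_div_iff₀ (by positivity)]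
    refine le_trans ?_ (hFb z hz.le)
    rw [hfG z, norm_mul, mul_comm, norm_prod]
    gcongr
    rw [← Finset.prod_const]
    apply Finset.prod_le_prod (fun _ _ => by norm_num)
    intro a ha
    have ha0 : 0 < ‖a‖ := norm_pos_iff.2 (hS0 a ha)
    have h1 : 3 ≤ ‖z / a‖ := by
      rw [norm_div, le_div_iff₀ ha0, hz]
      linarith [((hSmem a).1 ha).1]
    have h3 : 2 ≤ ‖1 - z / a‖ := by
      have := norm_sub_norm_le (z / a) 1
      rw [norm_sub_rev, norm_one] at this
      linarith
    rw [norm_pow]; nlinarith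
  have hGb := norm_le_of_sphere G hG (12 * R) _ (by positivity) hGs
  have hcard : (S.card : ℝ) ≤ A := by
    have h1 := hGb 0 (by simp; positivity)
    rw [hG0, le_div_iff₀ (by positivity)] at h1
    have h3 : (4 : ℝ) ^ S.card ≤ Real.exp A := le_of_mul_le_mul_left h1 (norm_pos_iff.2 hf0)
    have h4 : Real.exp S.card ≤ Real.exp A := by
      refine le_trans ?_ h3
      rw [← Real.exp_one_pow]
      gcongr
      linarith [Real.exp_one_lt_d9]
    exact Real.exp_le_exp.1 h4
  have hlog := logder G hG R A hRpos hApos hGne (by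
    intro z hz
    have hz' : ‖z‖ < 4 * R := by simpa using hz
    refine (hGb z (by linarith)).trans ?_
    rw [hG0]
    exact div_le_self (by positivity) (one_le_pow₀ (by norm_num)))
  obtain ⟨t, ht, htne, htsum⟩ := hpick S (fun k => ‖k‖ / R)
  have hX : ∑ a ∈ S, (|t - ‖a‖ / R|)⁻¹ ≤ D * R ^ (5 / 4 : ℝ) := by
    calc ∑ a ∈ S, (|t - ‖a‖ / R|)⁻¹
        = ∑ a ∈ S, (|t - ‖a‖ / R| ^ (-(9 / 10) : ℝ)) ^ (10 / 9 : ℝ) := by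
          apply Finset.sum_congr rfl
          intro a _
          rw [← Real.rpow_mul (abs_nonneg _)]
          norm_num
          rw [Real.rpow_neg_one]
      _ ≤ (∑ a ∈ S, |t - ‖a‖ / R| ^ (-(9 / 10) : ℝ)) ^ (10 / 9 : ℝ) :=
          sum_rpow_le S _ (fun a => by positivity) _ (by norm_num)
      _ ≤ (C₀ * A) ^ (10 / 9 : ℝ) := by
          refine Real.rpow_le_rpow (Finset.sum_nonneg (fun a _ => by positivity)) ?_ (by norm_num)
          exact htsum.trans (by gcongr)
      _ = D * R ^ (5 / 4 : ℝ) := by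
          rw [hA, ← mul_assoc, Real.mul_rpow (by positivity) (by positivity), ← Real.rpow_mul hRpos.le]
          norm_num [hD]
  refine ⟨t * R, ⟨by nlinarith [ht.1], by nlinarith [ht.2]⟩, fun z hz => ?_⟩
  have hz2 : ‖z‖ ≤ 2 * R := by rw [hz]; nlinarith [ht.2]
  have hfz : f z ≠ 0 := by
    intro h
    have : z ∈ S := (hSmem z).2 ⟨by linarith, h⟩
    apply htne z this
    rw [hz]; field_simp
  refine ⟨hfz, ?_⟩
  have hdist : ∀ a ∈ S, ‖(z - a)⁻¹‖ ≤ (|t - ‖a‖ / R|)⁻¹ / R := by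
    intro a ha
    have h1 : 0 < |t - ‖a‖ / R| := abs_pos.2 (sub_ne_zero.2 (htne a ha))
    rw [norm_inv, ← one_div, ← one_div, div_div]
    apply one_div_le_one_div_of_le (by positivity)
    have h3 := abs_norm_sub_norm_le z a
    rw [hz] at h3
    refine le_trans (le_of_eq ?_) h3
    rw [show t * R - ‖a‖ = (t - ‖a‖ / R) * R by field_simp, abs_mul, abs_of_pos hRpos]
  set y : ℝ := R ^ (1 / 4 : ℝ) with hy
  have hy1 : 1 ≤ y := Real.one_le_rpow hR (by norm_num)
  have hy2 : R ^ (1 / 2 : ℝ) = y ^ 2 := by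
    rw [hy, ← Real.rpow_natCast, ← Real.rpow_mul hRpos.le]; norm_num
  have hsum1 : ∑ a ∈ S, ‖(z - a)⁻¹‖ ≤ D * y := by
    refine (Finset.sum_le_sum hdist).trans ?_
    rw [← Finset.sum_div, div_le_iff₀ hRpos]
    refine hX.trans (le_of_eq ?_)
    rw [mul_assoc]
    congr 1
    nth_rewrite 2 [← Real.rpow_one R]
    rw [hy, ← Real.rpow_add hRpos]; norm_num
  have hsum2 : ∑ a ∈ S, ‖(z - a)⁻¹‖ ^ 2 ≤ (D * y) ^ 2 := by
    refine le_trans (Finset.sum_sq_le_sq_sum_of_nonneg (fun a _ => norm_nonneg _)) ?_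
    have : 0 ≤ ∑ a ∈ S, ‖(z - a)⁻¹‖ := Finset.sum_nonneg (fun a _ => norm_nonneg _)
    gcongr
  have hAR : A / R ≤ B * y := by
    rw [div_le_iff₀ hRpos, hA, mul_assoc]
    gcongr
    nth_rewrite 2 [← Real.rpow_one R]
    rw [hy, ← Real.rpow_add hRpos]
    exact Real.rpow_le_rpow_of_exponent_le hR (by norm_num)
  have hAR2 : A / R ^ 2 ≤ B * y ^ 2 := by
    have h1 : A / R ^ 2 ≤ A / R := by
      gcongr
      nlinarith
    have h3 : B * y ≤ B * y ^ 2 := by gcongr; nlinarith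
    linarith
  have hL : ∀ w, f w ≠ 0 → logDeriv f w = ∑ a ∈ S, 2 * (w - a)⁻¹ + logDeriv G w := by
    intro w hw
    have hfe : f = fun z => (∏ a ∈ S, (1 - z / a) ^ 2) * G z := funext hfG
    have hw' := hw
    rw [hfG w] at hw'
    have hpr := left_ne_zero_of_mul hw'
    have hfac := Finset.prod_ne_zero_iff.1 hpr
    conv_lhs => rw [hfe]
    rw [logDeriv_mul w hpr (right_ne_zero_of_mul hw') (by fun_prop) (hG w)]
    congr 1
    rw [logDeriv_prod (f := fun a z => (1 - z / a) ^ 2) hfac (fun a _ => by fun_prop)]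
    apply Finset.sum_congr rfl
    intro a ha
    have ha0 := hS0 a ha
    have h1 : 1 - w / a ≠ 0 := fun e => hfac a ha (by simp [e])
    have h3 : w - a ≠ 0 := by
      intro e; apply h1; rw [sub_eq_zero.1 e]; field_simp; simp
    have hd : HasDerivAt (fun z : ℂ => (1 - z / a) ^ 2) (2 * (1 - w / a) * (-(1 / a))) w := by
      have := (((hasDerivAt_id w).div_const a).const_sub 1).pow 2
      exact this.congr_deriv (by simp)
    rw [logDeriv_apply, hd.deriv]
    have h4 : a - w ≠ 0 := by rw [← neg_sub]; exact neg_ne_zero.2 h3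
    rw [show 1 - w / a = (a - w) / a by field_simp, ← neg_sub a w]
    field_simp
  have hzS : ∀ a ∈ S, z - a ≠ 0 := by
    intro a ha e
    exact hfz (by rw [sub_eq_zero.1 e]; exact ((hSmem a).1 ha).2)
  have hL' : deriv (logDeriv f) z = ∑ a ∈ S, 2 * (-((z - a)⁻¹) ^ 2) + deriv (logDeriv G) z := by
    have hev : logDeriv f =ᶠ[𝓝 z] fun w => ∑ a ∈ S, 2 * (w - a)⁻¹ + logDeriv G w := by
      filter_upwards [hf.continuous.continuousAt.eventually_ne hfz] with w hw using hL w hw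
    rw [hev.deriv_eq]
    have hGz : G z ≠ 0 := hGne z (by simp; linarith)
    have hdG : DifferentiableAt ℂ (logDeriv G) z := (hG.deriv z).div (hG z) hGz
    have hds : HasDerivAt (fun w => ∑ a ∈ S, 2 * (w - a)⁻¹) (∑ a ∈ S, 2 * (-((z - a)⁻¹) ^ 2)) z := by
      apply HasDerivAt.fun_sum
      intro a ha
      apply HasDerivAt.const_mul
      have := ((hasDerivAt_id z).sub_const a).inv (hzS a ha)
      exact this.congr_deriv (by simp [neg_div])
    exact (hds.add hdG.hasDerivAt).deriv
  obtain ⟨hl1, hl2⟩ := hlog z hz2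
  have e1 : ‖logDeriv f z‖ ≤ (2 * D + 12 * B) * y := by
    rw [hL z hfz]
    refine (norm_add_le _ _).trans ?_
    have : ‖∑ a ∈ S, 2 * (z - a)⁻¹‖ ≤ 2 * (D * y) := by
      rw [← Finset.mul_sum, norm_mul]
      simp only [Complex.norm_ofNat]
      have := norm_sum_le S (fun a => (z - a)⁻¹)
      linarith
    have h5 : 12 * A / R = 12 * (A / R) := by ring
    rw [h5] at hl1
    linarith
  have e2 : ‖deriv (logDeriv f) z‖ ≤ (2 * D ^ 2 + 24 * B) * y ^ 2 := by
    rw [hL']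
    refine (norm_add_le _ _).trans ?_
    have : ‖∑ a ∈ S, 2 * (-((z - a)⁻¹) ^ 2)‖ ≤ 2 * (D * y) ^ 2 := by
      rw [← Finset.mul_sum, norm_mul]
      simp only [Complex.norm_ofNat]
      have := norm_sum_le S (fun a => -((z - a)⁻¹) ^ 2)
      simp only [norm_neg, norm_pow] at this
      linarith
    have h5 : 24 * A / R ^ 2 = 24 * (A / R ^ 2) := by ring
    rw [h5] at hl2
    nlinarith
  rw [hy2]
  refine (norm_add_le _ _).trans ?_
  rw [norm_div, norm_div, norm_pow]
  simp only [Complex.norm_ofNat]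
  have e3 : ‖logDeriv f z‖ ^ 2 ≤ ((2 * D + 12 * B) * y) ^ 2 := by gcongr
  nlinarith
lemma exists_entire (h : ℂ → ℂ)
    (hh : ∀ b, ∃ φ : ℂ → ℂ, AnalyticAt ℂ φ b ∧ h =ᶠ[𝓝[≠] b] φ) :
    ∃ H : ℂ → ℂ, Differentiable ℂ H ∧ ∀ z, ContinuousAt h z → H z = h z := by
  refine ⟨fun z => limUnder (𝓝[≠] z) h, fun b => ?_, fun z hz => ?_⟩
  · obtain ⟨φ, hφ, he⟩ := hh b
    have hev : (fun z => limUnder (𝓝[≠] z) h) =ᶠ[𝓝 b] φ := by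
      have h1 : ∀ᶠ z in 𝓝 b, ∀ᶠ w in 𝓝[≠] z, h w = φ w := by
        have h2 := eventually_eventually_nhdsWithin.2 he
        rw [eventually_nhdsWithin_iff] at h2
        filter_upwards [h2] with z hz
        by_cases hzb : z = b
        · rw [hzb]; exact he
        · have h3 := hz hzb
          rw [nhdsWithin_eq_nhds.2 (isOpen_compl_singleton.mem_nhds hzb)] at h3
          exact h3.filter_mono nhdsWithin_le_nhds
      filter_upwards [h1, hφ.eventually_analyticAt] with z hz1 hz2
      apply Tendsto.limUnder_eq
      exact (hz2.continuousAt.tendsto.mono_left nhdsWithin_le_nhds).congr' (hz1.mono (fun _ h => h.symm))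
    exact hφ.differentiableAt.congr_of_eventuallyEq hev
  · exact Tendsto.limUnder_eq (hz.tendsto.mono_left nhdsWithin_le_nhds)

lemma const_of_growth (H : ℂ → ℂ) (hH : Differentiable ℂ H) (C : ℝ)
    (hC : ∀ R : ℝ, 1 ≤ R → ∃ r ∈ Set.Icc R (2 * R), ∀ z : ℂ, ‖z‖ = r →
      ‖H z‖ ≤ C * R ^ (1 / 2 : ℝ)) : ∃ c, ∀ z, H z = c := by
  refine ⟨H 0, fun z => ?_⟩
  refine is_const_of_deriv_eq_zero hH (fun w => ?_) z 0
  have hb : ∀ R : ℝ, 1 ≤ R → ∀ z : ℂ, ‖z‖ ≤ R → ‖H z‖ ≤ C * R ^ (1 / 2 : ℝ) := by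
    intro R hR z hz
    obtain ⟨r, hr, h⟩ := hC R hR
    exact norm_le_of_sphere H hH r _ (by linarith [hr.1]) h z (hz.trans hr.1)
  have hlim : Tendsto (fun R : ℝ => 2 * C * R ^ (-(1 / 2) : ℝ)) atTop (𝓝 (2 * C * 0)) :=
    (tendsto_rpow_neg_atTop (by norm_num)).const_mul _
  rw [mul_zero] at hlim
  rw [← norm_le_zero_iff]
  refine ge_of_tendsto hlim ?_
  filter_upwards [eventually_ge_atTop 1, eventually_ge_atTop (2 * ‖w‖)] with R hR1 hR2
  have := Complex.norm_deriv_le_of_forall_mem_sphere_norm_le (f := H) (c := w) (R := R / 2)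
    (C := C * R ^ (1 / 2 : ℝ)) (by linarith) hH.diffContOnCl ?_
  · refine this.trans (le_of_eq ?_)
    have hR : 0 < R := by linarith
    have : R ^ (1 / 2 : ℝ) = R ^ (-(1 / 2) : ℝ) * R := by
      nth_rewrite 3 [← Real.rpow_one R]
      rw [← Real.rpow_add hR]; norm_num
    rw [this]; field_simp
  · intro u hu
    apply hb R hR1
    have h1 : ‖u - w‖ = R / 2 := by simpa [dist_eq_norm] using hu
    have h2 : ‖u‖ ≤ ‖w‖ + ‖u - w‖ := by
      have := norm_add_le w (u - w); simpa using this
    linarith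

lemma hasDerivAt_iter (f : ℂ → ℂ) (hf : Differentiable ℂ f) (n : ℕ) (z : ℂ) :
    HasDerivAt (iteratedDeriv n f) (iteratedDeriv (n + 1) f z) z := by
  have h : Differentiable ℂ (iteratedDeriv n f) := by
    induction n with
    | zero => simpa using hf
    | succ n ih => rw [iteratedDeriv_succ]; exact ih.deriv
  rw [iteratedDeriv_succ]
  exact (h z).hasDerivAt

/-- final step -/
lemma finish (f : ℂ → ℂ) (s : ℕ) (hs4 : 4 ≤ s) (hse : Even s)
    (hf : Differentiable ℂ f) (hnc : ¬ ∃ c : ℂ, ∀ z, f z = c)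
    (hmult : ∀ z, f z = 0 → deriv f z = 0)
    (a : ℂ) (ha : a ≠ 0)
    (hE1 : ∀ z, f z = 0 → iteratedDeriv 2 f z = a)
    (hE2 : ∀ z, iteratedDeriv 2 f z = a → iteratedDeriv s f z = 0)
    (c : ℂ) (hc : ∀ z, iteratedDeriv 3 f z = c * iteratedDeriv 1 f z) :
    ∃ b : ℂ, ∀ z, f z = a * (z - b) ^ 2 / 2 := by
  have hd := hasDerivAt_iter f hf
  have hf' : ∀ z, HasDerivAt f (iteratedDeriv 1 f z) z := by
    intro z; simpa using hd 0 z
  have hconst : ∀ n, (∀ z, iteratedDeriv (n + 1) f z = 0) → ∀ z w, iteratedDeriv n f z = iteratedDeriv n f w := by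
    intro n h z w
    exact is_const_of_deriv_eq_zero (fun z => (hd n z).differentiableAt)
      (fun z => by rw [(hd n z).deriv, h]) z w
  have hstep : ∀ m z, iteratedDeriv (m + 3) f z = c * iteratedDeriv (m + 1) f z := by
    intro m
    induction m with
    | zero => simpa using hc
    | succ m ih =>
      intro z
      have h1 := (hd (m + 1) z).const_mul c
      rw [← funext ih] at h1
      have h2 := (hd (m + 3) z).unique h1
      rw [show m + 1 + 3 = m + 3 + 1 by ring, h2]
  have heven : ∀ k z, iteratedDeriv (2 + 2 * k) f z = c ^ k * iteratedDeriv 2 f z := by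
    intro k z
    induction k with
    | zero => simp
    | succ k ih =>
      rw [show 2 + 2 * (k + 1) = (2 * k + 1) + 3 by ring, hstep,
        show 2 * k + 1 + 1 = 2 + 2 * k by ring, ih]; ring
  obtain ⟨k, hk⟩ : ∃ k, s = 2 + 2 * k := by
    obtain ⟨j, hj⟩ := hse
    exact ⟨j - 1, by omega⟩
  by_cases hc0 : c = 0
  · -- polynomial case
    have h3 : ∀ z, iteratedDeriv 3 f z = 0 := by intro z; rw [hc, hc0, zero_mul]
    have hc2 := hconst 2 h3
    set e := iteratedDeriv 2 f 0 with he
    have h2 : ∀ z, iteratedDeriv 2 f z = e := fun z => hc2 z 0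
    have hd1 : ∀ z, iteratedDeriv 1 f z = iteratedDeriv 1 f 0 + e * z := by
      intro z
      have hh : ∀ w, HasDerivAt (fun w => iteratedDeriv 1 f w - e * w) (e - e * 1) w := by
        intro w
        have h5 := hd 1 w
        rw [h2] at h5
        exact h5.sub ((hasDerivAt_id w).const_mul e)
      have := is_const_of_deriv_eq_zero (fun w => (hh w).differentiableAt)
        (fun w => by rw [(hh w).deriv]; ring) z 0
      simp only [mul_zero, sub_zero] at this
      linear_combination this
    set p := iteratedDeriv 1 f 0 with hp
    have hfz : ∀ z, f z = f 0 + p * z + e / 2 * z ^ 2 := by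
      intro z
      have hh : ∀ w, HasDerivAt (fun w => f w - (p * w + e / 2 * w ^ 2))
          ((p + e * w) - (p * 1 + e / 2 * (2 * w))) w := by
        intro w
        have h5 := hf' w
        rw [hd1] at h5
        have h6 := ((hasDerivAt_id w).const_mul p).add (((hasDerivAt_id w).pow 2).const_mul (e / 2))
        exact (h5.sub h6).congr_deriv (by simp)
      have := is_const_of_deriv_eq_zero (fun w => (hh w).differentiableAt)
        (fun w => by rw [(hh w).deriv]; ring) z 0
      simp at this
      linear_combination this
    have hroot : ∃ b, f b = 0 := by
      by_cases he0 : e = 0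
      · have hp0 : p ≠ 0 := by
          intro hp0
          exact hnc ⟨f 0, fun z => by rw [hfz z, hp0, he0]; ring⟩
        refine ⟨-f 0 / p, ?_⟩
        rw [hfz, he0]; field_simp; ring
      · obtain ⟨x, hx⟩ := exists_quadratic_eq_zero (a := e / 2) (b := p) (c := f 0)
          (by simpa using he0) (IsAlgClosed.exists_eq_mul_self (discrim (e / 2) p (f 0)))
        exact ⟨x, by rw [hfz]; linear_combination hx⟩
    obtain ⟨b, hb⟩ := hroot
    have h4 : p + e * b = 0 := by
      rw [← hd1, iteratedDeriv_one]; exact hmult b hb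
    have h5 : e = a := by rw [← h2 b]; exact hE1 b hb
    have h6 := hfz b
    rw [hb] at h6
    refine ⟨b, fun z => ?_⟩
    rw [hfz z, ← h5]
    linear_combination -h6 + (z - b) * h4
  · exfalso
    suffices h : ∃ z, iteratedDeriv 2 f z = a by
      obtain ⟨z, hz⟩ := h
      have := hE2 z hz
      rw [hk, heven, hz] at this
      simp [hc0, ha] at this
    obtain ⟨μ, hμ⟩ := IsAlgClosed.exists_eq_mul_self c
    have hμ0 : μ ≠ 0 := by rintro rfl; exact hc0 (by simpa using hμ)
    have key : ∀ ν : ℂ, ν * ν = c → ∃ α, ∀ z,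
        iteratedDeriv 3 f z + ν * iteratedDeriv 2 f z = α * Complex.exp (ν * z) := by
      intro ν hν
      have hh : ∀ w, HasDerivAt (fun w => (iteratedDeriv 3 f w + ν * iteratedDeriv 2 f w) *
          Complex.exp (-(ν * w))) 0 w := by
        intro w
        have h5 := ((hd 3 w).add ((hd 2 w).const_mul ν)).mul (((hasDerivAt_id w).const_mul ν).neg.cexp)
        refine h5.congr_deriv ?_
        have h6 := hstep 1 w
        norm_num at h6 ⊢
        rw [h6, ← hν]
        ring
      refine ⟨(iteratedDeriv 3 f 0 + ν * iteratedDeriv 2 f 0), fun z => ?_⟩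
      have := is_const_of_deriv_eq_zero (fun w => (hh w).differentiableAt)
        (fun w => (hh w).deriv) z 0
      simp only [mul_zero, neg_zero, Complex.exp_zero, mul_one] at this
      rw [← this, mul_assoc, ← Complex.exp_add]; simp
    obtain ⟨α, hα⟩ := key μ hμ.symm
    obtain ⟨β, hβ⟩ := key (-μ) (by rw [hμ]; ring)
    have hw : ∀ z, 2 * μ * iteratedDeriv 2 f z = α * Complex.exp (μ * z) - β * (Complex.exp (μ * z))⁻¹ := by
      intro z
      rw [← Complex.exp_neg, ← neg_mul]
      linear_combination hα z - hβ z
    have hv : ∃ v : ℂ, v ≠ 0 ∧ α * v - β * v⁻¹ = 2 * μ * a := by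
      by_cases hα0 : α = 0
      · have hβ0 : β ≠ 0 := by
          intro hβ0
          have h2 : ∀ z, iteratedDeriv 2 f z = 0 := by
            intro z
            have := hw z
            simpa [hα0, hβ0, hμ0] using this
          have h3 : ∀ z, iteratedDeriv 1 f z = 0 := by
            intro z
            have h4 := hα z
            rw [h2, hc, hα0] at h4
            simpa [hc0] using h4
          exact hnc ⟨f 0, fun z => by simpa using hconst 0 h3 z 0⟩
        refine ⟨-β / (2 * μ * a), by simp [hβ0, hμ0, ha], ?_⟩
        rw [hα0]; field_simp; ring
      · by_cases hβ0 : β = 0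
        · refine ⟨2 * μ * a / α, by simp [hα0, hμ0, ha], ?_⟩
          rw [hβ0]; field_simp; ring
        · obtain ⟨x, hx⟩ := exists_quadratic_eq_zero (a := α) (b := -(2 * μ * a)) (c := -β)
            hα0 (IsAlgClosed.exists_eq_mul_self _)
          have hx0 : x ≠ 0 := by
            rintro rfl; apply hβ0; simpa using hx
          refine ⟨x, hx0, ?_⟩
          field_simp
          linear_combination hx
    obtain ⟨v, hv0, hv⟩ := hv
    refine ⟨Complex.log v / μ, ?_⟩
    have := hw (Complex.log v / μ)
    rw [mul_div_cancel₀ _ hμ0, Complex.exp_log hv0, hv] at this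
    exact mul_left_cancel₀ (by simp [hμ0]) this

lemma h_local (f : ℂ → ℂ) (hf : Differentiable ℂ f) (hf0 : f 0 ≠ 0)
    (hmult : ∀ z, f z = 0 → deriv f z = 0)
    (h2 : ∀ z, f z = 0 → iteratedDeriv 2 f z ≠ 0)
    (h3 : ∀ z, f z = 0 → iteratedDeriv 3 f z = 0) (b : ℂ) :
    ∃ φ : ℂ → ℂ, AnalyticAt ℂ φ b ∧
      (fun z => (2 * f z * iteratedDeriv 2 f z - iteratedDeriv 1 f z ^ 2) / (4 * f z ^ 2))
        =ᶠ[𝓝[≠] b] φ := by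
  have hd := hasDerivAt_iter f hf
  have hf' : ∀ z, HasDerivAt f (iteratedDeriv 1 f z) z := by
    intro z; simpa using hd 0 z
  have han : ∀ n, AnalyticAt ℂ (iteratedDeriv n f) b := by
    intro n
    exact Differentiable.analyticAt (fun z => (hd n z).differentiableAt) b
  have hfan : AnalyticAt ℂ f b := hf.analyticAt b
  have h1an := han 1
  have h2an := han 2
  by_cases hb : f b = 0
  · obtain ⟨u, hu, hfu⟩ := exists_div_sq f hf b hb (hmult b hb)
    have hub : u b ≠ 0 := by
      intro e
      apply h2 b hb
      rw [second_deriv_of_div_sq f u hu b hfu, e, mul_zero]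
    set P : ℂ → ℂ := fun z => 2 * f z * iteratedDeriv 2 f z - iteratedDeriv 1 f z ^ 2 with hP
    have hPan : AnalyticAt ℂ P b := by
      rw [hP]; fun_prop
    have p1 : deriv P = fun z => 2 * f z * iteratedDeriv 3 f z := by
      funext z
      have := (((hf' z).const_mul 2).mul (hd 2 z)).sub ((hd 1 z).pow 2)
      refine this.deriv.trans ?_
      norm_num
    have p2 : deriv (fun z => 2 * f z * iteratedDeriv 3 f z) = fun z =>
        2 * iteratedDeriv 1 f z * iteratedDeriv 3 f z + 2 * f z * iteratedDeriv 4 f z := by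
      funext z
      exact (((hf' z).const_mul 2).mul (hd 3 z)).deriv
    have p3 : deriv (fun z => 
        2 * iteratedDeriv 1 f z * iteratedDeriv 3 f z + 2 * f z * iteratedDeriv 4 f z) = fun z =>
        (2 * iteratedDeriv 2 f z * iteratedDeriv 3 f z + 2 * iteratedDeriv 1 f z * iteratedDeriv 4 f z)
        + (2 * iteratedDeriv 1 f z * iteratedDeriv 4 f z + 2 * f z * iteratedDeriv 5 f z) := by
      funext z
      exact ((((hd 1 z).const_mul 2).mul (hd 3 z)).add (((hf' z).const_mul 2).mul (hd 4 z))).deriv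
    have hb1 : iteratedDeriv 1 f b = 0 := by rw [iteratedDeriv_one]; exact hmult b hb
    have hb3 := h3 b hb
    have hord : ((4 : ℕ) : ℕ∞) ≤ analyticOrderAt P b := by
      rw [natCast_le_analyticOrderAt_iff_iteratedDeriv_eq_zero hPan]
      intro i hi
      interval_cases i
      · simp only [iteratedDeriv_zero, hP, hb, hb1]; ring
      · rw [iteratedDeriv_one, p1]; simp [hb]
      · rw [iteratedDeriv_succ, iteratedDeriv_one, p1, p2]; simp [hb, hb1]
      · rw [iteratedDeriv_succ, iteratedDeriv_succ, iteratedDeriv_one, p1, p2, p3]; simp [hb, hb1, hb3]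
    obtain ⟨p, hp, hPp⟩ := (natCast_le_analyticOrderAt hPan).1 hord
    have huan : AnalyticAt ℂ u b := hu.analyticAt b
    refine ⟨fun z => p z / (4 * u z ^ 2), hp.div (by fun_prop) (by simp [hub]), ?_⟩
    filter_upwards [hPp.filter_mono nhdsWithin_le_nhds, self_mem_nhdsWithin,
      (hu.continuous.continuousAt.eventually_ne hub).filter_mono nhdsWithin_le_nhds] with z hz hzb huz
    have hzb' : z - b ≠ 0 := sub_ne_zero.2 hzb
    have hz' : 2 * f z * iteratedDeriv 2 f z - iteratedDeriv 1 f z ^ 2 = (z - b) ^ 4 * p z := hz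
    rw [hz', hfu z]
    field_simp
  · refine ⟨_, ?_, EventuallyEq.rfl⟩
    refine AnalyticAt.div (by fun_prop) (by fun_prop) (by simp [hb])

lemma main_zero (f : ℂ → ℂ) (s : ℕ) (hs4 : 4 ≤ s) (hse : Even s)
    (hf : Differentiable ℂ f) (hf0 : f 0 ≠ 0) (hnc : ¬ ∃ c : ℂ, ∀ z, f z = c)
    (K : ℝ) (hK : ∀ R : ℝ, 1 ≤ R → ∀ z : ℂ, ‖z‖ ≤ R → ‖f z‖ ≤ Real.exp (K * R ^ (9 / 8 : ℝ)))
    (hmult : ∀ z, f z = 0 → deriv f z = 0)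
    (a : ℂ) (ha : a ≠ 0)
    (hE1 : ∀ z, f z = 0 → iteratedDeriv 2 f z = a)
    (hE2 : ∀ z, iteratedDeriv 2 f z = a →
      iteratedDeriv 3 f z = 0 ∧ iteratedDeriv s f z = 0) :
    ∃ b : ℂ, ∀ z, f z = a * (z - b) ^ 2 / 2 := by
  have hd := hasDerivAt_iter f hf
  have hf' : ∀ z, HasDerivAt f (iteratedDeriv 1 f z) z := by
    intro z; simpa using hd 0 z
  have h2 : ∀ z, f z = 0 → iteratedDeriv 2 f z ≠ 0 := fun z hz => by rw [hE1 z hz]; exact ha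
  have h3 : ∀ z, f z = 0 → iteratedDeriv 3 f z = 0 := fun z hz => (hE2 z (hE1 z hz)).1
  obtain ⟨C, hC⟩ := growth f hf hf0 hmult h2 K hK
  obtain ⟨H, hH, hHh⟩ := exists_entire _ (h_local f hf hf0 hmult h2 h3)
  have hHf : ∀ z, f z ≠ 0 → H z =
      (2 * f z * iteratedDeriv 2 f z - iteratedDeriv 1 f z ^ 2) / (4 * f z ^ 2) := by
    intro z hz
    refine hHh z ?_
    have c1 := (hd 1 z).continuousAt
    have c2 := (hd 2 z).continuousAt
    have c0 := (hf z).continuousAt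
    exact ContinuousAt.div (by fun_prop) (by fun_prop) (by simp [hz])
  obtain ⟨c, hc⟩ := const_of_growth H hH C (by
    intro R hR
    obtain ⟨r, hr, h⟩ := hC R hR
    refine ⟨r, hr, fun z hz => ?_⟩
    obtain ⟨hfz, hb⟩ := h z hz
    rw [hHf z hfz]
    refine le_trans (le_of_eq ?_) hb
    congr 1
    have e1 : logDeriv f = fun w => iteratedDeriv 1 f w / f w := by
      funext w; rw [logDeriv_apply, iteratedDeriv_one]
    have e2 := ((hd 1 z).div (hf' z) hfz).deriv
    have e3 : deriv (logDeriv f) z = (iteratedDeriv 2 f z * f z -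
        iteratedDeriv 1 f z * iteratedDeriv 1 f z) / f z ^ 2 := by
      rw [e1]; exact e2
    rw [e3, e1]
    field_simp
    ring)
  have hP : ∀ z, 2 * f z * iteratedDeriv 2 f z - iteratedDeriv 1 f z ^ 2 = 4 * c * f z ^ 2 := by
    intro z
    by_cases hz : f z = 0
    · rw [iteratedDeriv_one, hmult z hz, hz]; ring
    · have := hHf z hz
      rw [hc z] at this
      rw [this]; field_simp
  refine finish f s hs4 hse hf hnc hmult a ha hE1 (fun z hz => (hE2 z hz).2) (4 * c) (fun z => ?_)
  by_cases hz : f z = 0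
  · rw [iteratedDeriv_one, hmult z hz, h3 z hz, mul_zero]
  · have d1 := (((hf' z).const_mul 2).mul (hd 2 z)).sub ((hd 1 z).pow 2)
    have d2 := ((hf' z).pow 2).const_mul (4 * c)
    have hfe : ((fun y => 2 * f y) * iteratedDeriv 2 f - iteratedDeriv 1 f ^ 2)
      = fun y => 4 * c * (f ^ 2) y := funext hP
    rw [hfe] at d1
    have := d1.unique d2
    norm_num at this
    rw [iteratedDeriv_one]
    apply mul_left_cancel₀ hz
    linear_combination this / 2

end Helpers

/-- A nonconstant entire function of order at most 1, all of whose zeros are multiple,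
with `E_f(0) ⊆ E_{f''}(a) ⊆ E_{f'''}(0) ∩ E_{f^{(s)}}(0)` for an even `s ≥ 4`,
is `a (z - b)^2 / 2`. -/
theorem stmt_1 (f : ℂ → ℂ) (s : ℕ) (hs4 : 4 ≤ s) (hse : Even s)
    (hf : Differentiable ℂ f) (hnc : ¬ ∃ c : ℂ, ∀ z, f z = c)
    (horder : ∀ ε : ℝ, 0 < ε → ∃ C : ℝ, ∀ z : ℂ, ‖f z‖ ≤ C * Real.exp (‖z‖ ^ (1 + ε)))
    (hmult : ∀ z, f z = 0 → deriv f z = 0)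
    (a : ℂ) (ha : a ≠ 0)
    (hE1 : ∀ z, f z = 0 → iteratedDeriv 2 f z = a)
    (hE2 : ∀ z, iteratedDeriv 2 f z = a →
      iteratedDeriv 3 f z = 0 ∧ iteratedDeriv s f z = 0) :
    ∃ b : ℂ, ∀ z, f z = a * (z - b) ^ 2 / 2 := by
  obtain ⟨z₀, hz₀⟩ : ∃ z₀, f z₀ ≠ 0 := by
    by_contra h
    push Not at h
    exact hnc ⟨0, h⟩
  obtain ⟨C, hC⟩ := horder (1 / 8) (by norm_num)
  have hC0 : 0 ≤ C := by
    have h1 := (norm_nonneg _).trans (hC 0)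
    exact nonneg_of_mul_nonneg_left h1 (Real.exp_pos _)
  set g : ℂ → ℂ := fun z => f (z + z₀) with hg
  have hit : ∀ n z, iteratedDeriv n g z = iteratedDeriv n f (z + z₀) := by
    intro n z
    rw [hg, iteratedDeriv_comp_add_const]
  have hder : ∀ z, deriv g z = deriv f (z + z₀) := by
    intro z; rw [← iteratedDeriv_one, ← iteratedDeriv_one, hit]
  obtain ⟨b, hb⟩ := main_zero g s hs4 hse (hf.comp (by fun_prop)) (by simpa [hg] using hz₀)
    (by
      rintro ⟨c, hc⟩
      exact hnc ⟨c, fun z => by simpa [hg] using hc (z - z₀)⟩)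
    (C + (1 + ‖z₀‖) ^ (9 / 8 : ℝ)) (by
      intro R hR z hz
      have hR98 : 1 ≤ R ^ (9 / 8 : ℝ) := Real.one_le_rpow hR (by norm_num)
      refine (hC (z + z₀)).trans ?_
      have h1 : ‖z + z₀‖ ^ (1 + 1 / 8 : ℝ) ≤ (1 + ‖z₀‖) ^ (9 / 8 : ℝ) * R ^ (9 / 8 : ℝ) := by
        rw [← Real.mul_rpow (by positivity) (by linarith), show (1 + 1 / 8 : ℝ) = 9 / 8 by norm_num]
        apply Real.rpow_le_rpow (norm_nonneg _) _ (by norm_num)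
        have := norm_add_le z z₀
        nlinarith [norm_nonneg z₀]
      have h2 : C ≤ Real.exp (C * R ^ (9 / 8 : ℝ)) := by
        have := Real.add_one_le_exp (C * R ^ (9 / 8 : ℝ))
        nlinarith
      rw [add_mul, Real.exp_add]
      gcongr)
    (fun z hz => by rw [hder]; exact hmult _ hz) a ha
    (fun z hz => by rw [hit]; exact hE1 _ hz)
    (fun z hz => by rw [hit] at hz ⊢; rw [hit]; exact hE2 _ hz)
  refine ⟨b + z₀, fun z => ?_⟩
  have := hb (z - z₀)
  simp only [hg, sub_add_cancel] at this
  rw [this]; ring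
end
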